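/- arXiv:1902.10429 — 2 statements merged into one kernel-verified Lean document; each statement's English description precedes it below -/
import Mathlib

section
/- Let G be a finite simple graph on {x_1,...,x_n} and S an independent set of G with |S| = d - s, where d = dim R/I(G) and s = deg h_{R/I(G)}(λ). In the S-suspension G^S, one has dim R'/I(G^S) = d and h_s(R'/I(G^S)) = h_s(R/I(G)) + (-1)^{s-1}, provided s ≥ 1 and G has no isolated vertices. -/
open MvPolynomial PowerSeries

/-- A matching of a simple graph: a set of pairwise disjoint edges. -/
def IsMatchingSet {V : Type*} (G : SimpleGraph V) (M : Finset (Sym2 V)) : Prop :=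
  (↑M : Set (Sym2 V)) ⊆ G.edgeSet ∧
    ∀ e ∈ M, ∀ f ∈ M, e ≠ f → ∀ v, v ∈ e → v ∉ f

/-- An induced matching: a matching such that no edge of `G` meets two distinct
edges of the matching. -/
def IsInducedMatchingSet {V : Type*} (G : SimpleGraph V) (M : Finset (Sym2 V)) : Prop :=
  IsMatchingSet G M ∧
    ∀ e ∈ G.edgeSet, ∀ f ∈ M, ∀ g ∈ M, f ≠ g →
      ¬((∃ v, v ∈ e ∧ v ∈ f) ∧ (∃ w, w ∈ e ∧ w ∈ g))

/-- The matching number `m(G)`. -/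
noncomputable def matchNum {V : Type*} (G : SimpleGraph V) : ℕ :=
  sSup {k | ∃ M : Finset (Sym2 V), IsMatchingSet G M ∧ M.card = k}

/-- The induced matching number `im(G)`. -/
noncomputable def indMatchNum {V : Type*} (G : SimpleGraph V) : ℕ :=
  sSup {k | ∃ M : Finset (Sym2 V), IsInducedMatchingSet G M ∧ M.card = k}

/-- The `S`-suspension `G^S`: add a new vertex (`none`) joined to every vertex not in `S`. -/
def sSusp {V : Type*} (G : SimpleGraph V) (S : Set V) : SimpleGraph (Option V) :=
  SimpleGraph.fromRel (fun a b =>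
    (∃ x y, a = some x ∧ b = some y ∧ G.Adj x y) ∨
    (a = none ∧ ∃ y, b = some y ∧ y ∉ S))

/-- The `{x_i,x_j}, S`-suspension: add a new vertex (`none`) joined to every vertex
outside `S ∪ {i, j}`. -/
def eSusp {V : Type*} (G : SimpleGraph V) (i j : V) (S : Set V) : SimpleGraph (Option V) :=
  SimpleGraph.fromRel (fun a b =>
    (∃ x y, a = some x ∧ b = some y ∧ G.Adj x y) ∨
    (a = none ∧ ∃ y, b = some y ∧ y ∉ S ∧ y ≠ i ∧ y ≠ j))

/-- The edge ideal of a graph. -/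
noncomputable def edgeIdeal (K : Type*) [Field K] {σ : Type*} (G : SimpleGraph σ) :
    Ideal (MvPolynomial σ K) :=
  Ideal.span {p | ∃ i j, G.Adj i j ∧ p = X i * X j}

/-- The Hilbert function of `R/I` (standard grading). -/
noncomputable def hilbFun (K : Type*) [Field K] {σ : Type*}
    (I : Ideal (MvPolynomial σ K)) (n : ℕ) : ℕ :=
  Module.finrank K ((homogeneousSubmodule σ K n).map
    (Ideal.Quotient.mkₐ K I).toLinearMap)

/-- The Hilbert series of `R/I`, as a power series over `ℚ`. -/
noncomputable def hilbSeries (K : Type*) [Field K] {σ : Type*}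
    (I : Ideal (MvPolynomial σ K)) : PowerSeries ℚ :=
  PowerSeries.mk fun n => (hilbFun K I n : ℚ)

/-- `HilbEq K I d h` says that the Hilbert series of `R/I` equals `h(λ)/(1-λ)^d`
with `h(1) ≠ 0`, i.e. `h` is the `h`-polynomial and `d = dim R/I`. -/
def HilbEq (K : Type*) [Field K] {σ : Type*} (I : Ideal (MvPolynomial σ K))
    (d : ℕ) (h : Polynomial ℤ) : Prop :=
  hilbSeries K I * (1 - PowerSeries.X) ^ d =
    ((h.map (Int.castRingHom ℚ) : Polynomial ℚ) : PowerSeries ℚ) ∧ h.eval 1 ≠ 0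

/-- `regBound K I r` : there is a finite graded free resolution of `R/I` all of whose
generator degrees in homological degree `i` are at most `i + r`.  The minimal free
resolution realizes `r = reg(R/I)`, and the generator degrees of any graded free
resolution contain those of the minimal one, hence
`reg(R/I) = sInf {r | regBound K I r}`. -/
noncomputable def regBound (K : Type*) [Field K] {σ : Type*}
    (I : Ideal (MvPolynomial σ K)) (r : ℕ) : Prop :=
  ∃ (L : ℕ) (k : ℕ → ℕ) (d : (i : ℕ) → Fin (k i) → ℕ)
    (φ : (i : ℕ) → ((Fin (k (i + 1)) →₀ MvPolynomial σ K) →ₗ[MvPolynomial σ K]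
      (Fin (k i) →₀ MvPolynomial σ K)))
    (ε : (Fin (k 0) →₀ MvPolynomial σ K) →ₗ[MvPolynomial σ K] (MvPolynomial σ K ⧸ I)),
    (∀ i, L ≤ i → k i = 0) ∧
    (∀ (i : ℕ) (b : Fin (k (i + 1))) (a : Fin (k i)),
      (φ i (Finsupp.single b 1)) a ∈ homogeneousSubmodule σ K (d (i + 1) b - d i a) ∧
      (d (i + 1) b < d i a → (φ i (Finsupp.single b 1)) a = 0)) ∧
    (∀ a : Fin (k 0), ε (Finsupp.single a 1) ∈
      (homogeneousSubmodule σ K (d 0 a)).map (Ideal.Quotient.mkₐ K I).toLinearMap) ∧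
    Function.Surjective ε ∧
    LinearMap.range (φ 0) = LinearMap.ker ε ∧
    (∀ i : ℕ, LinearMap.range (φ (i + 1)) = LinearMap.ker (φ i)) ∧
    (∀ (i : ℕ) (a : Fin (k i)), d i a ≤ i + r)

/-- The Castelnuovo–Mumford regularity of `R/I`. -/
noncomputable def reg (K : Type*) [Field K] {σ : Type*}
    (I : Ideal (MvPolynomial σ K)) : ℕ :=
  sInf {r | regBound K I r}

section Helpers

open Classical in
/-- Independent sets. -/
noncomputable def indepF {σ : Type*} [Fintype σ] (G : SimpleGraph σ) : Finset (Finset σ) :=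
  Finset.univ.filter fun F => ∀ x ∈ F, ∀ y ∈ F, ¬ G.Adj x y

theorem mem_indepF {σ : Type*} [Fintype σ] {G : SimpleGraph σ} {F : Finset σ} :
    F ∈ indepF G ↔ ∀ x ∈ F, ∀ y ∈ F, ¬ G.Adj x y := by
  simp [indepF]

theorem mem_edgeIdeal (K : Type*) [Field K] {σ : Type*} [Fintype σ] (G : SimpleGraph σ)
    (p : MvPolynomial σ K) :
    p ∈ edgeIdeal K G ↔ ∀ m ∈ p.support, m.support ∉ indepF G := by
  classical
  have : edgeIdeal K G = Ideal.span ((fun s => MvPolynomial.monomial s (1 : K)) ''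
      {m | ∃ i j, G.Adj i j ∧ m = Finsupp.single i 1 + Finsupp.single j 1}) := by
    unfold edgeIdeal
    congr 1
    ext p
    constructor
    · rintro ⟨i, j, h, rfl⟩
      exact ⟨_, ⟨i, j, h, rfl⟩, by simp [MvPolynomial.X, MvPolynomial.monomial_mul]⟩
    · rintro ⟨_, ⟨i, j, h, rfl⟩, rfl⟩
      exact ⟨i, j, h, by simp [MvPolynomial.X, MvPolynomial.monomial_mul]⟩
  rw [this, MvPolynomial.mem_ideal_span_monomial_image]
  refine forall₂_congr fun m _ => ?_
  rw [mem_indepF]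
  push Not
  constructor
  · rintro ⟨_, ⟨i, j, h, rfl⟩, hle⟩
    have hij := h.ne
    have h1 := hle i
    have h2 := hle j
    refine ⟨i, ?_, j, ?_, h⟩ <;> simp at h1 h2 ⊢ <;> omega
  · rintro ⟨i, hi, j, hj, h⟩
    have hij := h.ne
    refine ⟨_, ⟨i, j, h, rfl⟩, fun k => ?_⟩
    simp only [Finsupp.mem_support_iff] at hi hj
    simp only [Finsupp.add_apply, Finsupp.single_apply]
    split_ifs with a b b
    · exact absurd (a.trans b.symm) hij
    all_goals (try subst a); (try subst b); omega

/-- The standard monomials of degree `n`. -/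
def stdMon {σ : Type*} [Fintype σ] (G : SimpleGraph σ) (n : ℕ) : Set (σ →₀ ℕ) :=
  {m | m.degree = n ∧ m.support ∈ indepF G}

theorem hilbFun_eq (K : Type*) [Field K] {σ : Type*} [Fintype σ] (G : SimpleGraph σ) (n : ℕ) :
    hilbFun K (edgeIdeal K G) n = Nat.card (stdMon G n) := by
  unfold hilbFun
  set f := (Ideal.Quotient.mkₐ K (edgeIdeal K G)).toLinearMap with hf
  have hf0 : ∀ p, f p = 0 ↔ p ∈ edgeIdeal K G := fun p => by
    simp [hf, Ideal.Quotient.eq_zero_iff_mem]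
  have h1 : (homogeneousSubmodule σ K n).map f
      = (restrictSupport K (stdMon G n)).map f := by
    apply le_antisymm
    · rintro _ ⟨p, hp, rfl⟩
      rw [SetLike.mem_coe, mem_homogeneousSubmodule] at hp
      rw [p.as_sum, map_sum]
      refine Submodule.sum_mem _ fun m hm => ?_
      by_cases hi : m.support ∈ indepF G
      · refine Submodule.mem_map_of_mem ?_
        rw [monomial_mem_restrictSupport]
        left
        refine ⟨?_, hi⟩
        have := hp (MvPolynomial.mem_support_iff.1 hm)
        rwa [Finsupp.degree_eq_weight_one]
      · have : f (monomial m (coeff m p)) = 0 := by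
          rw [hf0, mem_edgeIdeal]
          intro m' hm'
          have := Finset.mem_of_subset MvPolynomial.support_monomial_subset hm'
          rw [Finset.mem_singleton] at this
          rwa [this]
        rw [this]; exact zero_mem _
    · apply Submodule.map_mono
      intro p hp
      rw [mem_restrictSupport_iff] at hp
      rw [mem_homogeneousSubmodule]
      intro m hm
      have := (hp (MvPolynomial.mem_support_iff.2 hm)).1
      rwa [Finsupp.degree_eq_weight_one] at this
  rw [h1]
  have hinj : Function.Injective (f.domRestrict (restrictSupport K (stdMon G n))) := by
    rw [← LinearMap.ker_eq_bot, LinearMap.ker_eq_bot']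
    rintro ⟨p, hp⟩ h0
    rw [LinearMap.domRestrict_apply, hf0, mem_edgeIdeal] at h0
    rw [mem_restrictSupport_iff] at hp
    ext1
    change p = 0
    rw [← MvPolynomial.support_eq_empty, Finset.eq_empty_iff_forall_notMem]
    intro m hm
    exact h0 m hm (hp hm).2
  rw [← LinearMap.range_domRestrict, LinearMap.finrank_range_of_inj hinj,
    Module.finrank_eq_nat_card_basis (basisRestrictSupport K (stdMon G n))]

/-- The series `λ/(1-λ)`. -/
noncomputable def gser : PowerSeries ℚ := PowerSeries.mk fun k => if k = 0 then 0 else 1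

theorem gser_mul : gser * (1 - PowerSeries.X) = PowerSeries.X := by
  ext k
  rw [mul_sub, mul_one, map_sub]
  rcases k with _ | k
  · simp [gser]
  · rw [PowerSeries.coeff_succ_mul_X, PowerSeries.coeff_X]
    rcases k with _ | k <;> simp [gser]

theorem coeff_gser_pow {σ : Type*} [DecidableEq σ] (F : Finset σ) (n : ℕ) :
    PowerSeries.coeff n (gser ^ F.card) =
      (((Finset.finsuppAntidiag F n).filter fun m => m.support = F).card : ℚ) := by
  rw [← Finset.prod_const, PowerSeries.coeff_prod, Finset.card_filter]
  push_cast
  refine Finset.sum_congr rfl fun m hm => ?_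
  rw [Finset.mem_finsuppAntidiag] at hm
  simp only [gser, PowerSeries.coeff_mk]
  split_ifs with h
  · apply Finset.prod_eq_one
    intro i hi
    rw [← h, Finsupp.mem_support_iff] at hi
    simp [hi]
  · have : ∃ i ∈ F, i ∉ m.support := by
      by_contra hc
      push Not at hc
      exact h (le_antisymm hm.2 hc)
    obtain ⟨i, hi, him⟩ := this
    apply Finset.prod_eq_zero hi
    rw [Finsupp.notMem_support_iff] at him
    simp [him]

theorem hilbSeries_eq (K : Type*) [Field K] {σ : Type*} [Fintype σ] (G : SimpleGraph σ) :
    hilbSeries K (edgeIdeal K G) = ∑ F ∈ indepF G, gser ^ F.card := by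
  classical
  ext n
  rw [map_sum, hilbSeries, PowerSeries.coeff_mk, hilbFun_eq]
  simp only [coeff_gser_pow]
  rw [← Nat.cast_sum, Nat.cast_inj, ← Finset.card_biUnion]
  · rw [Nat.card_coe_set_eq, ← Set.ncard_coe_finset]
    congr 1
    ext m
    simp only [stdMon, Set.mem_ofPred_eq, Finset.coe_biUnion, Set.mem_iUnion, Finset.mem_coe,
      Finset.mem_filter, Finset.mem_finsuppAntidiag]
    constructor
    · rintro ⟨h1, h2⟩
      exact ⟨m.support, h2, ⟨by rw [← h1]; rfl, subset_rfl⟩, rfl⟩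
    · rintro ⟨F, hF, ⟨h1, -⟩, rfl⟩
      exact ⟨by rw [← h1]; rfl, hF⟩
  · intro F _ F' _ hne
    rw [Function.onFun, Finset.disjoint_left]
    intro m h1 h2
    rw [Finset.mem_filter] at h1 h2
    exact hne (h1.2.symm.trans h2.2)

theorem dim_ge (K : Type*) [Field K] {σ : Type*} [Fintype σ] (G : SimpleGraph σ)
    (F : Finset σ) (hF : F ∈ indepF G) :
    (((F.card : ℕ) : ℕ∞) : WithBot ℕ∞) ≤ ringKrullDim (MvPolynomial σ K ⧸ edgeIdeal K G) := by
  classical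
  rw [mem_indepF] at hF
  let g : MvPolynomial σ K →ₐ[K] MvPolynomial F K :=
    MvPolynomial.aeval fun i => if h : i ∈ F then X ⟨i, h⟩ else 0
  have hg : ∀ a ∈ edgeIdeal K G, g.toRingHom a = 0 := by
    intro a ha
    have : edgeIdeal K G ≤ RingHom.ker g.toRingHom := by
      unfold edgeIdeal
      rw [Ideal.span_le]
      rintro _ ⟨i, j, h, rfl⟩
      rw [SetLike.mem_coe, RingHom.mem_ker]
      by_cases hi : i ∈ F
      · have hj : j ∉ F := fun hj => hF i hi j hj h
        simp [g, hj]
      · simp [g, hi]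
    exact this ha
  have hsurj : Function.Surjective (Ideal.Quotient.lift (edgeIdeal K G) g.toRingHom hg) := by
    apply Ideal.Quotient.lift_surjective_of_surjective
    intro p
    refine ⟨rename Subtype.val p, ?_⟩
    change g (rename Subtype.val p) = p
    simp only [g, aeval_rename]
    conv_rhs => rw [← aeval_X_left_apply p]
    congr 2
    funext i
    simp
  have h := ringKrullDim_le_of_surjective _ hsurj
  rw [MvPolynomial.ringKrullDim_of_isNoetherianRing, ringKrullDim_eq_zero_of_field] at h
  simpa using h

theorem dim_le (K : Type*) [Field K] {σ : Type*} [Fintype σ] (G : SimpleGraph σ) (d : ℕ)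
    (hd : ∀ F ∈ indepF G, F.card ≤ d) :
    ringKrullDim (MvPolynomial σ K ⧸ edgeIdeal K G) ≤ ((d : ℕ∞) : WithBot ℕ∞) := by
  classical
  rw [ringKrullDim_quotient, Order.krullDim]
  refine iSup_le fun l => ?_
  set p := l.head.1 with hp
  have hpI : edgeIdeal K G ≤ p.asIdeal := l.head.2
  let F : Finset σ := Finset.univ.filter fun i => X i ∉ p.asIdeal
  have hF : F ∈ indepF G := by
    rw [mem_indepF]
    intro x hx y hy hxy
    simp only [F, Finset.mem_filter, Finset.mem_univ, true_and] at hx hy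
    have : (X x * X y : MvPolynomial σ K) ∈ p.asIdeal :=
      hpI (Ideal.subset_span ⟨x, y, hxy, rfl⟩)
    rcases p.isPrime.mem_or_mem this with h | h
    · exact hx h
    · exact hy h
  have h1 : ringKrullDim (MvPolynomial σ K ⧸ p.asIdeal) ≤ ((F.card : ℕ∞) : WithBot ℕ∞) := by
    let g : MvPolynomial F K →ₐ[K] (MvPolynomial σ K ⧸ p.asIdeal) :=
      MvPolynomial.aeval fun i => Ideal.Quotient.mkₐ K p.asIdeal (X i.1)
    have hsurj : Function.Surjective g.toRingHom := by
      intro q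
      obtain ⟨q, rfl⟩ := Ideal.Quotient.mkₐ_surjective K p.asIdeal q
      change Ideal.Quotient.mkₐ K p.asIdeal q ∈ g.range
      induction q using MvPolynomial.induction_on with
      | C a => 
        have : Ideal.Quotient.mkₐ K p.asIdeal (C a) = algebraMap K _ a := by
          rw [← MvPolynomial.algebraMap_eq]; exact AlgHom.commutes _ _
        rw [this]; exact Subalgebra.algebraMap_mem _ _
      | add a b ha hb => rw [map_add]; exact add_mem ha hb
      | mul_X a i ha =>
        rw [map_mul]
        refine mul_mem ha ?_
        by_cases hi : i ∈ F
        · exact ⟨X ⟨i, hi⟩, by simp [g]⟩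
        · have : Ideal.Quotient.mkₐ K p.asIdeal (X i) = 0 := by
            rw [Ideal.Quotient.mkₐ_eq_mk, Ideal.Quotient.eq_zero_iff_mem]
            simpa [F] using hi
          rw [this]; exact zero_mem _
    have h := ringKrullDim_le_of_surjective _ hsurj
    rw [MvPolynomial.ringKrullDim_of_isNoetherianRing, ringKrullDim_eq_zero_of_field] at h
    simpa using h
  have h2 : ((l.length : ℕ∞) : WithBot ℕ∞) ≤ ringKrullDim (MvPolynomial σ K ⧸ p.asIdeal) := by
    rw [ringKrullDim_quotient]
    let l' : LTSeries (PrimeSpectrum.zeroLocus (p.asIdeal : Set (MvPolynomial σ K))) :=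
      { length := l.length
        toFun := fun i => ⟨(l i).1, by
          have : l.head ≤ l i := LTSeries.head_le l i
          exact this⟩
        step := fun i => l.step i }
    exact Order.LTSeries.length_le_krullDim l'
  refine le_trans ?_ (h2.trans (h1.trans ?_))
  · exact le_rfl
  · exact_mod_cast hd F hF

theorem dim_spec (K : Type*) [Field K] {σ : Type*} [Fintype σ] (G : SimpleGraph σ) (d : ℕ)
    (hdim : ringKrullDim (MvPolynomial σ K ⧸ edgeIdeal K G) = ((d : ℕ∞) : WithBot ℕ∞)) :
    (∀ F ∈ indepF G, F.card ≤ d) ∧ ∃ F ∈ indepF G, F.card = d := by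
  have h1 : ∀ F ∈ indepF G, F.card ≤ d := by
    intro F hF
    have := dim_ge K G F hF
    rw [hdim] at this
    exact_mod_cast this
  refine ⟨h1, ?_⟩
  by_contra hc
  push Not at hc
  have h0 : ∅ ∈ indepF G := by simp [mem_indepF]
  have hd0 : 0 < d := by
    have := hc ∅ h0
    simp at this; omega
  have := dim_le K G (d - 1) fun F hF => by
    have := h1 F hF
    have := hc F hF
    omega
  rw [hdim] at this
  have : d ≤ d - 1 := by exact_mod_cast this
  omega

/-- The `h`-polynomial of the independence complex. -/
noncomputable def hpol {σ : Type*} [Fintype σ] (G : SimpleGraph σ) (d : ℕ) : Polynomial ℤ :=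
  ∑ F ∈ indepF G, Polynomial.X ^ F.card * (1 - Polynomial.X) ^ (d - F.card)

theorem hpol_series (K : Type*) [Field K] {σ : Type*} [Fintype σ] (G : SimpleGraph σ) (d : ℕ)
    (hd : ∀ F ∈ indepF G, F.card ≤ d) :
    hilbSeries K (edgeIdeal K G) * (1 - PowerSeries.X) ^ d =
    (((hpol G d).map (Int.castRingHom ℚ) : Polynomial ℚ) : PowerSeries ℚ) := by
  have : (((hpol G d).map (Int.castRingHom ℚ) : Polynomial ℚ) : PowerSeries ℚ) =
      ∑ F ∈ indepF G, PowerSeries.X ^ F.card * (1 - PowerSeries.X) ^ (d - F.card) := by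
    rw [hpol, Polynomial.map_sum, ← Polynomial.coeToPowerSeries.ringHom_apply, map_sum]
    simp
  rw [this, hilbSeries_eq, Finset.sum_mul]
  refine Finset.sum_congr rfl fun F hF => ?_
  obtain ⟨k, hk⟩ := Nat.exists_eq_add_of_le (hd F hF)
  rw [hk, Nat.add_sub_cancel_left, pow_add, ← mul_assoc, ← mul_pow, gser_mul]

theorem hpol_eval {σ : Type*} [Fintype σ] (G : SimpleGraph σ) (d : ℕ)
    (hd : ∃ F ∈ indepF G, F.card = d) : (hpol G d).eval 1 ≠ 0 := by
  obtain ⟨F, hF, rfl⟩ := hd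
  apply ne_of_gt
  rw [hpol, Polynomial.eval_finsetSum]
  apply Finset.sum_pos' 
  · intro F' _
    simp only [Polynomial.eval_mul, Polynomial.eval_pow, Polynomial.eval_sub, Polynomial.eval_one,
      Polynomial.eval_X, sub_self]
    positivity
  · exact ⟨F, hF, by simp⟩

theorem hpol_deg {σ : Type*} [Fintype σ] (G : SimpleGraph σ) (d : ℕ)
    (hd : ∀ F ∈ indepF G, F.card ≤ d) : (hpol G d).natDegree ≤ d := by
  apply Polynomial.natDegree_sum_le_of_forall_le
  intro F hF
  have := hd F hF
  refine Polynomial.natDegree_mul_le.trans ?_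
  have h1 := Polynomial.natDegree_X_pow_le (R := ℤ) F.card
  have h2 : ((1 - Polynomial.X : Polynomial ℤ) ^ (d - F.card)).natDegree ≤ (d - F.card) * 1 :=
    Polynomial.natDegree_pow_le_of_le _ (by compute_degree)
  omega

theorem sSusp_some {V : Type*} (G : SimpleGraph V) (S : Set V) (x y : V) :
    (sSusp G S).Adj (some x) (some y) ↔ G.Adj x y := by
  simp only [sSusp, SimpleGraph.fromRel_adj]
  constructor
  · rintro ⟨-, (⟨_, _, h1, h2, h⟩ | ⟨h, -⟩) | (⟨_, _, h1, h2, h⟩ | ⟨h, -⟩)⟩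
    · cases h1; cases h2; exact h
    · cases h
    · cases h1; cases h2; exact h.symm
    · cases h
  · intro h
    exact ⟨by simpa using h.ne, Or.inl (Or.inl ⟨x, y, rfl, rfl, h⟩)⟩

theorem sSusp_none {V : Type*} (G : SimpleGraph V) (S : Set V) (y : V) :
    (sSusp G S).Adj none (some y) ↔ y ∉ S := by
  simp [sSusp, SimpleGraph.fromRel_adj]

theorem indepF_susp {V : Type*} [Fintype V] [DecidableEq V] (G : SimpleGraph V) (S : Finset V)
    (hS : S ∈ indepF G) :
    indepF (sSusp G (↑S : Set V)) =
      (indepF G).image (fun F => F.map Function.Embedding.some) ∪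
      S.powerset.image Finset.insertNone := by
  rw [mem_indepF] at hS
  ext F
  simp only [Finset.mem_union, Finset.mem_image, Finset.mem_powerset]
  constructor
  · intro hF
    rw [mem_indepF] at hF
    by_cases hn : none ∈ F
    · right
      refine ⟨Finset.eraseNone F, fun x hx => ?_, by
        rw [Finset.insertNone_eraseNone, Finset.insert_eq_of_mem hn]⟩
      rw [Finset.mem_eraseNone] at hx
      have := hF _ hn _ hx
      rw [sSusp_none] at this
      simpa using this
    · left
      refine ⟨Finset.eraseNone F, ?_, by
        rw [Finset.map_some_eraseNone, Finset.erase_eq_of_notMem hn]⟩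
      rw [mem_indepF]
      intro x hx y hy h
      rw [Finset.mem_eraseNone] at hx hy
      exact hF _ hx _ hy ((sSusp_some _ _ _ _).2 h)
  · rintro (⟨F, hF, rfl⟩ | ⟨T, hT, rfl⟩)
    · rw [mem_indepF] at hF ⊢
      intro x hx y hy
      simp only [Finset.mem_map, Function.Embedding.some_apply] at hx hy
      obtain ⟨x, hx, rfl⟩ := hx
      obtain ⟨y, hy, rfl⟩ := hy
      rw [sSusp_some]
      exact hF _ hx _ hy
    · rw [mem_indepF]
      rintro (_ | x) hx (_ | y) hy
      · exact SimpleGraph.irrefl _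
      · rw [Finset.some_mem_insertNone] at hy
        rw [sSusp_none]
        simpa using hT hy
      · rw [Finset.some_mem_insertNone] at hx
        rw [SimpleGraph.adj_comm, sSusp_none]
        simpa using hT hx
      · rw [Finset.some_mem_insertNone] at hx hy
        rw [sSusp_some]
        exact hS _ (hT hx) _ (hT hy)

theorem hpol_susp {V : Type*} [Fintype V] (G : SimpleGraph V) (S : Finset V)
    (hS : S ∈ indepF G) (d k : ℕ) (hd : d = S.card + 1 + k) :
    hpol (sSusp G (↑S : Set V)) d = hpol G d + Polynomial.X * (1 - Polynomial.X) ^ k := by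
  classical
  unfold hpol
  rw [indepF_susp G S hS, Finset.sum_union, Finset.sum_image, Finset.sum_image]
  · simp only [Finset.card_map, Finset.card_insertNone]
    congr 1
    have h := Finset.sum_pow_mul_eq_add_pow (Polynomial.X : Polynomial ℤ) (1 - Polynomial.X) S
    rw [add_sub_cancel, one_pow] at h
    refine Eq.trans ?_ ((congrArg (fun z => Polynomial.X * (1 - Polynomial.X) ^ k * z) h).trans
      (mul_one _))
    simp only [Finset.mul_sum]
    refine Finset.sum_congr rfl fun T hT => ?_
    have := Finset.card_le_card (Finset.mem_powerset.1 hT)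
    have e : d - (T.card + 1) = k + (S.card - T.card) := by omega
    rw [e]; ring
  · intro a _ b _ h
    exact Finset.insertNone.injective h
  · intro a _ b _ h
    exact Finset.map_injective _ h
  · rw [Finset.disjoint_left]
    intro F h1 h2
    simp only [Finset.mem_image] at h1 h2
    obtain ⟨A, -, rfl⟩ := h1
    obtain ⟨B, -, h⟩ := h2
    have : none ∈ Finset.insertNone B := Finset.none_mem_insertNone
    rw [h] at this
    simp at this

theorem coeff_one_sub_X_pow (k : ℕ) :
    (((1 : Polynomial ℤ) - Polynomial.X) ^ k).coeff k = (-1) ^ k := by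
  have h := Polynomial.coeff_pow_of_natDegree_le (p := (1 : Polynomial ℤ) - Polynomial.X)
    (m := k) (n := 1) (by compute_degree)
  simpa [Polynomial.coeff_one] using h

end Helpers

/-- for `|S| = d - s`, the `S`-suspension satisfies
`dim R'/I(G^S) = d` and `h_s(R'/I(G^S)) = h_s(R/I(G)) + (-1)^{s-1}`. -/
theorem stmt_11 (K : Type*) [Field K] {n : ℕ} (G : SimpleGraph (Fin n))
    (hiso : ∀ v : Fin n, ∃ w, G.Adj v w) (d s : ℕ) (hs : 1 ≤ s)
    (h : Polynomial ℤ) (hh : HilbEq K (edgeIdeal K G) d h)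
    (hdim : ringKrullDim (MvPolynomial (Fin n) K ⧸ edgeIdeal K G) = ((d : ℕ∞) : WithBot ℕ∞))
    (hdeg : h.natDegree = s) (hne : h ≠ 0)
    (S : Finset (Fin n)) (hS : ∀ x ∈ S, ∀ y ∈ S, ¬ G.Adj x y)
    (hcard : S.card = d - s) :
    ringKrullDim (MvPolynomial (Option (Fin n)) K ⧸ edgeIdeal K (sSusp G (↑S : Set (Fin n)))) =
      ((d : ℕ∞) : WithBot ℕ∞) ∧
    ∃ h' : Polynomial ℤ,
      HilbEq K (edgeIdeal K (sSusp G (↑S : Set (Fin n)))) d h' ∧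
      h'.coeff s = h.coeff s + (-1) ^ (s - 1) := by
  have hSi : S ∈ indepF G := mem_indepF.2 hS
  obtain ⟨hle, F₀, hF₀, hF₀c⟩ := dim_spec K G d hdim
  have hh' : h = hpol G d := by
    have e := hh.1.symm.trans (hpol_series K G d hle)
    exact Polynomial.map_injective _ (Int.cast_injective) (Polynomial.coe_injective _ e)
  have hsd : s ≤ d := by
    rw [← hdeg, hh']; exact hpol_deg G d hle
  have hle' : ∀ F ∈ indepF (sSusp G (↑S : Set (Fin n))), F.card ≤ d := by
    intro F hF
    rw [indepF_susp G S hSi] at hF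
    simp only [Finset.mem_union, Finset.mem_image, Finset.mem_powerset] at hF
    rcases hF with ⟨F, hF, rfl⟩ | ⟨T, hT, rfl⟩
    · rw [Finset.card_map]; exact hle F hF
    · rw [Finset.card_insertNone]
      have := Finset.card_le_card hT
      omega
  have hex' : ∃ F ∈ indepF (sSusp G (↑S : Set (Fin n))), F.card = d := by
    refine ⟨F₀.map Function.Embedding.some, ?_, by rw [Finset.card_map, hF₀c]⟩
    rw [indepF_susp G S hSi]
    exact Finset.mem_union_left _ (Finset.mem_image_of_mem _ hF₀)
  refine ⟨le_antisymm (dim_le K _ d hle') ?_, hpol (sSusp G (↑S : Set (Fin n))) d,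
    ⟨hpol_series K _ d hle', hpol_eval _ d hex'⟩, ?_⟩
  · obtain ⟨F, hF, hc⟩ := hex'
    rw [← hc]
    exact dim_ge K _ F hF
  · rw [hpol_susp G S hSi d (s - 1) (by omega), hh', Polynomial.coeff_add]
    congr 1
    obtain ⟨k, rfl⟩ := Nat.exists_eq_add_of_le' hs
    rw [Nat.add_sub_cancel, Polynomial.coeff_X_mul, coeff_one_sub_X_pow]
end

section
/- Let G be a finite simple graph with no isolated vertices and S an independent set of G. Then reg(R'/I(G^S)) = reg(R/I(G)), where G^S is the S-suspension of G obtained by adding a new vertex adjacent to all vertices not in S. -/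
open MvPolynomial PowerSeries

namespace S14

universe u v

/-- graded pieces of a free module with generators in degrees `d`. -/
noncomputable def Fgr (K : Type u) [Field K] (σ : Type v) {ι : Type} (d : ι → ℕ) (n : ℕ) :
    AddSubgroup (ι → MvPolynomial σ K) where
  carrier := {w | ∀ a, w a ∈ homogeneousSubmodule σ K (n - d a) ∧ (n < d a → w a = 0)}
  zero_mem' := fun a => ⟨Submodule.zero_mem _, fun _ => rfl⟩
  add_mem' := fun {x y} hx hy a => ⟨Submodule.add_mem _ (hx a).1 (hy a).1, fun h => by
    simp [(hx a).2 h, (hy a).2 h]⟩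
  neg_mem' := fun {x} hx a => ⟨Submodule.neg_mem _ (hx a).1, fun h => by
    simp [(hx a).2 h]⟩

/-- being a grading. -/
structure IsGr (K : Type u) [Field K] (σ : Type v) {M : Type (max u v)} [AddCommGroup M]
    [Module (MvPolynomial σ K) M] (gr : ℕ → AddSubgroup M) : Prop where
  smul : ∀ (i n : ℕ) (r : MvPolynomial σ K) (m : M), r ∈ homogeneousSubmodule σ K i →
    m ∈ gr n → r • m ∈ gr (i + n)
  comp : ∃ c : ℕ → M →+ M, (∀ n m, c n m ∈ gr n) ∧ (∀ n m, m ∈ gr n → c n m = m) ∧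
    (∀ n k m, n ≠ k → m ∈ gr n → c k m = 0) ∧
    (∀ m, ∃ N, m = ∑ n ∈ Finset.range N, c n m)

theorem commute {M M' : Type*} [AddCommGroup M] [AddCommGroup M']
    {gr : ℕ → AddSubgroup M} {gr' : ℕ → AddSubgroup M'}
    (c : ℕ → M →+ M) (c' : ℕ → M' →+ M')
    (h1 : ∀ n m, c n m ∈ gr n) (h2 : ∀ n m, m ∈ gr n → c n m = m)
    (h3 : ∀ n k m, n ≠ k → m ∈ gr n → c k m = 0)
    (h4 : ∀ m, ∃ N, m = ∑ n ∈ Finset.range N, c n m)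
    (h2' : ∀ n m, m ∈ gr' n → c' n m = m)
    (h3' : ∀ n k m, n ≠ k → m ∈ gr' n → c' k m = 0)
    (f : M →+ M') (hf : ∀ n m, m ∈ gr n → f m ∈ gr' n) (k : ℕ) (m : M) :
    c' k (f m) = f (c k m) := by
  have key : ∀ n, c' k (f (c n m)) = f (c k (c n m)) := by
    intro n
    by_cases h : n = k
    · subst h
      rw [h2' n _ (hf n _ (h1 n m)), h2 n _ (h1 n m)]
    · rw [h3' n k _ h (hf n _ (h1 n m)), h3 n k _ h (h1 n m), map_zero]
  obtain ⟨N, hN⟩ := h4 m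
  rw [hN]
  simp only [map_sum]
  exact Finset.sum_congr rfl fun n _ => key n

section
variable {K : Type u} [Field K] {σ : Type v}
variable {M M' : Type (max u v)} [AddCommGroup M] [Module (MvPolynomial σ K) M]
  [AddCommGroup M'] [Module (MvPolynomial σ K) M']
  {gr : ℕ → AddSubgroup M} {gr' : ℕ → AddSubgroup M'}

theorem IsGr.strict (h : IsGr K σ gr) (h' : IsGr K σ gr') (f : M →ₗ[MvPolynomial σ K] M')
    (hf : ∀ n m, m ∈ gr n → f m ∈ gr' n) (hs : Function.Surjective f) (n : ℕ) (y : M')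
    (hy : y ∈ gr' n) : ∃ x ∈ gr n, f x = y := by
  obtain ⟨c, h1, h2, h3, h4⟩ := h.comp
  obtain ⟨c', h1', h2', h3', h4'⟩ := h'.comp
  obtain ⟨x, rfl⟩ := hs y
  refine ⟨c n x, h1 n x, ?_⟩
  have := commute c c' h1 h2 h3 h4 h2' h3' f.toAddMonoidHom hf n x
  simp only [LinearMap.toAddMonoidHom_coe] at this
  rw [← this, h2' _ _ hy]

/-- induced grading on a submodule -/
noncomputable def subGr (gr : ℕ → AddSubgroup M) (N : Submodule (MvPolynomial σ K) M) (n : ℕ) : AddSubgroup N :=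
  (gr n).comap N.subtype.toAddMonoidHom

theorem mem_subGr (N : Submodule (MvPolynomial σ K) M) (n : ℕ) (x : N) :
    x ∈ subGr gr N n ↔ (x : M) ∈ gr n := Iff.rfl

theorem IsGr.ker (h : IsGr K σ gr) (h' : IsGr K σ gr') (f : M →ₗ[MvPolynomial σ K] M')
    (hf : ∀ n m, m ∈ gr n → f m ∈ gr' n) : IsGr K σ (subGr gr (LinearMap.ker f)) := by
  obtain ⟨c, h1, h2, h3, h4⟩ := h.comp
  obtain ⟨c', h1', h2', h3', h4'⟩ := h'.comp
  have hc := commute c c' h1 h2 h3 h4 h2' h3' f.toAddMonoidHom hf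
  simp only [LinearMap.toAddMonoidHom_coe] at hc
  have hk : ∀ n (x : LinearMap.ker f), c n x ∈ LinearMap.ker f := by
    intro n x
    rw [LinearMap.mem_ker, ← hc, LinearMap.mem_ker.1 x.2, map_zero]
  refine ⟨fun i n r m hr hm => h.smul i n r m hr hm,
    fun n => ⟨⟨fun x => ⟨c n x, hk n x⟩, ?_⟩, ?_⟩, ?_, ?_, ?_, ?_⟩
  · ext; simp
  · intro x y; ext; simp
  · intro n m; exact h1 n m
  · intro n m hm; ext; exact h2 n m hm
  · intro n k m hnk hm; ext; exact h3 n k m hnk hm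
  · intro m
    obtain ⟨N, hN⟩ := h4 m
    refine ⟨N, ?_⟩
    ext
    rw [hN]
    simp [← hN]

theorem IsGr.quot (h : IsGr K σ gr) (f : M →ₗ[MvPolynomial σ K] M')
    (hs : Function.Surjective f) (hgr : ∀ n y, y ∈ gr' n ↔ ∃ x ∈ gr n, f x = y)
    (hk : ∀ (c : ℕ → M →+ M), (∀ n m, c n m ∈ gr n) → (∀ n m, m ∈ gr n → c n m = m) →
      (∀ n k m, n ≠ k → m ∈ gr n → c k m = 0) → (∀ m, ∃ N, m = ∑ n ∈ Finset.range N, c n m) →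
      ∀ n m, f m = 0 → f (c n m) = 0) : IsGr K σ gr' := by
  obtain ⟨c, h1, h2, h3, h4⟩ := h.comp
  have hk := hk c h1 h2 h3 h4
  have key : ∀ n x y, f x = f y → f (c n x) = f (c n y) := by
    intro n x y hxy
    have := hk n (x - y) (by rw [map_sub, hxy, sub_self])
    rwa [map_sub, map_sub, sub_eq_zero] at this
  let c' : ℕ → M' →+ M' := fun n => ⟨⟨fun y => f (c n (Function.surjInv hs y)), by
      rw [key n _ 0 (by rw [Function.surjInv_eq hs, map_zero]), map_zero, map_zero]⟩, by
      intro x y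
      rw [← map_add, ← map_add]
      apply key
      simp [Function.surjInv_eq hs]⟩
  have hc' : ∀ n x, c' n (f x) = f (c n x) := fun n x =>
    key n _ _ (Function.surjInv_eq hs _)
  refine ⟨?_, c', ?_, ?_, ?_, ?_⟩
  · intro i n r m hr hm
    obtain ⟨x, hx, rfl⟩ := (hgr _ _).1 hm
    exact (hgr _ _).2 ⟨r • x, h.smul i n r x hr hx, by simp⟩
  · intro n m
    exact (hgr _ _).2 ⟨_, h1 _ _, rfl⟩
  · intro n m hm
    obtain ⟨x, hx, rfl⟩ := (hgr _ _).1 hm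
    rw [hc', h2 n x hx]
  · intro n k m hnk hm
    obtain ⟨x, hx, rfl⟩ := (hgr _ _).1 hm
    rw [hc', h3 n k x hnk hx, map_zero]
  · intro m
    obtain ⟨x, rfl⟩ := hs m
    obtain ⟨N, hN⟩ := h4 x
    refine ⟨N, ?_⟩
    simp only [hc']
    rw [← map_sum, ← hN]

theorem isGr_Fgr {ι : Type} [Fintype ι] (d : ι → ℕ) : IsGr K σ (Fgr K σ d) := by
  refine ⟨?_, ?_⟩
  · intro i n r m hr hm a
    refine ⟨?_, ?_⟩
    · by_cases h : n < d a
      · simp [(hm a).2 h]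
      · have : i + n - d a = i + (n - d a) := by omega
        rw [this]
        exact IsHomogeneous.mul hr (hm a).1
    · intro h
      simp [(hm a).2 (by omega)]
  · refine ⟨fun n => ⟨⟨fun w a => if d a ≤ n then homogeneousComponent (n - d a) (w a) else 0, ?_⟩,
      ?_⟩, ?_, ?_, ?_, ?_⟩
    · ext a; simp
    · intro x y; ext1 a; simp only [Pi.add_apply]; split_ifs <;> simp
    · intro n m a
      refine ⟨?_, fun h => ?_⟩
      · simp only [AddMonoidHom.coe_mk, ZeroHom.coe_mk]
        split_ifs
        · exact homogeneousComponent_mem _ _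
        · exact Submodule.zero_mem _
      · simp only [AddMonoidHom.coe_mk, ZeroHom.coe_mk]
        rw [if_neg (by omega)]
    · intro n m hm
      ext1 a
      simp only [AddMonoidHom.coe_mk, ZeroHom.coe_mk]
      split_ifs with h
      · exact homogeneousComponent_eq_self (hm a).1
      · rw [(hm a).2 (by omega)]
    · intro n k m hnk hm
      ext1 a
      simp only [AddMonoidHom.coe_mk, ZeroHom.coe_mk]
      split_ifs with h
      · by_cases h' : n < d a
        · rw [(hm a).2 h']; simp
        · rw [homogeneousComponent_of_mem (hm a).1, if_neg (by omega)]; rfl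
      · rfl
    · intro m
      refine ⟨∑ a, (d a + (m a).totalDegree + 1), ?_⟩
      ext1 a
      set N := ∑ a, (d a + (m a).totalDegree + 1) with hN
      have hle : d a + (m a).totalDegree + 1 ≤ N :=
        Finset.single_le_sum (f := fun a => d a + (m a).totalDegree + 1) (fun _ _ => Nat.zero_le _)
          (Finset.mem_univ a)
      rw [Finset.sum_apply]
      simp only [AddMonoidHom.coe_mk, ZeroHom.coe_mk]
      obtain ⟨t, ht⟩ : ∃ t, N = d a + ((m a).totalDegree + 1 + t) :=
        ⟨N - (d a + ((m a).totalDegree + 1)), by omega⟩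
      rw [ht, Finset.sum_range_add, Finset.sum_eq_zero, zero_add]
      · simp only [Nat.le_add_right, if_true, Nat.add_sub_cancel_left]
        rw [Finset.sum_range_add, sum_homogeneousComponent, Finset.sum_eq_zero, add_zero]
        intro x _
        exact homogeneousComponent_eq_zero _ _ (by omega)
      · intro x hx
        rw [if_neg (by simpa using hx)]

theorem single_mem_Fgr {ι : Type} [DecidableEq ι] (d : ι → ℕ) (a : ι) :
    (Pi.single a 1 : ι → MvPolynomial σ K) ∈ Fgr K σ d (d a) := by
  intro b
  by_cases h : b = a
  · subst h
    refine ⟨?_, fun h => absurd h (lt_irrefl _)⟩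
    rw [Pi.single_eq_same, Nat.sub_self]
    exact isHomogeneous_one σ K
  · simp [Pi.single_eq_of_ne h]

/-- grading on a quotient ring -/
noncomputable def qgr (I : Ideal (MvPolynomial σ K)) (n : ℕ) : AddSubgroup (MvPolynomial σ K ⧸ I) :=
  ((homogeneousSubmodule σ K n).map (Ideal.Quotient.mkₐ K I).toLinearMap).toAddSubgroup

theorem mem_qgr (I : Ideal (MvPolynomial σ K)) (n : ℕ) (y : MvPolynomial σ K ⧸ I) :
    y ∈ qgr I n ↔ ∃ p ∈ homogeneousSubmodule σ K n, Ideal.Quotient.mk I p = y := Iff.rfl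

/-- the grading of the polynomial ring -/
noncomputable def hgr (K : Type u) [Field K] (σ : Type v) (n : ℕ) : AddSubgroup (MvPolynomial σ K) :=
  (homogeneousSubmodule σ K n).toAddSubgroup

theorem isGr_hgr : IsGr K σ (hgr K σ) := by
  refine ⟨fun i n r m hr hm => IsHomogeneous.mul hr hm,
    fun n => (homogeneousComponent n).toAddMonoidHom, ?_, ?_, ?_, ?_⟩
  · intro n m; exact homogeneousComponent_mem _ _
  · intro n m hm; exact homogeneousComponent_eq_self hm
  · intro n k m hnk hm
    change homogeneousComponent k m = 0
    rw [homogeneousComponent_of_mem hm, if_neg hnk.symm]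
  · intro m
    exact ⟨m.totalDegree + 1, (sum_homogeneousComponent m).symm⟩

/-- homogeneous ideals -/
def HI (I : Ideal (MvPolynomial σ K)) : Prop := ∀ p ∈ I, ∀ n, homogeneousComponent n p ∈ I

theorem HI_span (s : Set (MvPolynomial σ K)) (hs : ∀ p ∈ s, ∃ n, p ∈ homogeneousSubmodule σ K n) :
    HI (Ideal.span s) := by
  intro p hp n
  let _ : GradedAlgebra (homogeneousSubmodule σ K) := MvPolynomial.gradedAlgebra
  exact homogeneousComponent_mem_of_mem
    (Ideal.homogeneous_span (homogeneousSubmodule σ K) s (fun x hx => hs x hx)) hp n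

theorem isGr_qgr (I : Ideal (MvPolynomial σ K)) (hI : HI I) : IsGr K σ (qgr I) := by
  refine isGr_hgr.quot (Submodule.mkQ I) (Submodule.mkQ_surjective I) (fun n y => Iff.rfl) ?_
  intro c h1 h2 h3 h4 n m hm
  have : c n m = homogeneousComponent n m := by
    have := commute (gr := hgr K σ) (gr' := hgr K σ)
      c (fun n => (homogeneousComponent n).toAddMonoidHom) h1 h2 h3 h4
      (fun n m hm => homogeneousComponent_eq_self hm) (fun n k m hnk hm => by
        change homogeneousComponent k m = 0
        rw [homogeneousComponent_of_mem hm, if_neg hnk.symm]) (AddMonoidHom.id _)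
      (fun n m hm => hm) n m
    exact this.symm
  rw [this, Submodule.mkQ_apply, Submodule.Quotient.mk_eq_zero]
  rw [Submodule.mkQ_apply, Submodule.Quotient.mk_eq_zero] at hm
  exact hI m hm n

end

end S14

namespace S14

universe u v

/-- existence of a finite graded free resolution of length `L`, with degree bounds. -/
def HasRes (K : Type u) [Field K] (σ : Type v) : ℕ → (M : Type (max u v)) → [AddCommGroup M] →
    [Module (MvPolynomial σ K) M] → (ℕ → AddSubgroup M) → ℕ → Prop
  | 0, M, _, _, _, _ => Subsingleton M
  | L + 1, M, _, _, gr, b => ∃ (ι : Type) (_ : Fintype ι) (d : ι → ℕ) (m : ι → M),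
      (∀ a, d a ≤ b) ∧ (∀ a, m a ∈ gr (d a)) ∧
      Function.Surjective (Fintype.linearCombination (MvPolynomial σ K) m) ∧
      HasRes K σ L (LinearMap.ker (Fintype.linearCombination (MvPolynomial σ K) m))
        (subGr (Fgr K σ d) _) (b + 1)

section
variable {K : Type u} [Field K] {σ : Type v}
variable {M M' : Type (max u v)} [AddCommGroup M] [Module (MvPolynomial σ K) M]
  [AddCommGroup M'] [Module (MvPolynomial σ K) M']
  {gr : ℕ → AddSubgroup M} {gr' : ℕ → AddSubgroup M'}

theorem lc_graded (h : IsGr K σ gr) {ι : Type} [Fintype ι] (d : ι → ℕ) (m : ι → M)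
    (hm : ∀ a, m a ∈ gr (d a)) (n : ℕ) (w : ι → MvPolynomial σ K) (hw : w ∈ Fgr K σ d n) :
    Fintype.linearCombination (MvPolynomial σ K) m w ∈ gr n := by
  rw [Fintype.linearCombination_apply]
  refine AddSubgroup.sum_mem _ fun a _ => ?_
  by_cases h' : n < d a
  · rw [(hw a).2 h', zero_smul]; exact AddSubgroup.zero_mem _
  · have := h.smul (n - d a) (d a) (w a) (m a) (hw a).1 (hm a)
    rwa [Nat.sub_add_cancel (by omega)] at this

theorem isGr_lc_ker (h : IsGr K σ gr) {ι : Type} [Fintype ι] (d : ι → ℕ) (m : ι → M)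
    (hm : ∀ a, m a ∈ gr (d a)) :
    IsGr K σ (subGr (Fgr K σ d) (LinearMap.ker (Fintype.linearCombination (MvPolynomial σ K) m))) :=
  (isGr_Fgr d).ker h _ (lc_graded h d m hm)

theorem lc_sum {ι κ : Type} [Fintype ι] [Fintype κ] (p : ι → M) (q : κ → M)
    (w : ι ⊕ κ → MvPolynomial σ K) :
    Fintype.linearCombination (MvPolynomial σ K) (Sum.elim p q) w =
      Fintype.linearCombination (MvPolynomial σ K) p (fun a => w (Sum.inl a)) +
      Fintype.linearCombination (MvPolynomial σ K) q (fun a => w (Sum.inr a)) := by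
  simp [Fintype.linearCombination_apply, Fintype.sum_sum_type]

theorem lc_map {ι : Type} [Fintype ι] (p : ι → M) (f : M →ₗ[MvPolynomial σ K] M')
    (w : ι → MvPolynomial σ K) :
    f (Fintype.linearCombination (MvPolynomial σ K) p w) =
      Fintype.linearCombination (MvPolynomial σ K) (fun a => f (p a)) w := by
  simp [Fintype.linearCombination_apply]

theorem HasRes.congr : ∀ {L : ℕ} {M M' : Type (max u v)} [AddCommGroup M]
    [Module (MvPolynomial σ K) M] [AddCommGroup M'] [Module (MvPolynomial σ K) M']
    {gr : ℕ → AddSubgroup M} {gr' : ℕ → AddSubgroup M'} {b : ℕ}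
    (_ : HasRes K σ L M gr b) (e : M ≃ₗ[MvPolynomial σ K] M')
    (_ : ∀ n x, x ∈ gr n → e x ∈ gr' n), HasRes K σ L M' gr' b
  | 0, M, M', _, _, _, _, gr, gr', b, h, e, he => by
      have : Subsingleton M := h
      exact e.symm.injective.subsingleton
  | L + 1, M, M', _, _, _, _, gr, gr', b, h, e, he => by
      obtain ⟨ι, _, d, m, h1, h2, h3, h4⟩ := h
      have hl : ∀ w, Fintype.linearCombination (MvPolynomial σ K) (fun a => e (m a)) w =
          e (Fintype.linearCombination (MvPolynomial σ K) m w) := fun w =>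
        (lc_map m e.toLinearMap w).symm
      refine ⟨ι, inferInstance, d, fun a => e (m a), h1, fun a => he _ _ (h2 a), ?_, ?_⟩
      · intro y
        obtain ⟨w, hw⟩ := h3 (e.symm y)
        exact ⟨w, by rw [hl, hw, e.apply_symm_apply]⟩
      · refine HasRes.congr h4 (LinearEquiv.ofEq _ _ ?_) ?_
        · ext w
          rw [LinearMap.mem_ker, LinearMap.mem_ker, hl, LinearEquiv.map_eq_zero_iff]
        · intro n x hx
          exact hx

theorem HasRes.of_subsingleton : ∀ (L : ℕ) {M : Type (max u v)} [AddCommGroup M]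
    [Module (MvPolynomial σ K) M] {gr : ℕ → AddSubgroup M} {b : ℕ} (_ : Subsingleton M),
    HasRes K σ L M gr b
  | 0, _, _, _, _, _, h => h
  | L + 1, M, _, _, gr, b, h => by
      refine ⟨Empty, inferInstance, fun a => a.elim, fun a => a.elim, fun a => a.elim,
        fun a => a.elim, fun y => ⟨0, Subsingleton.elim _ _⟩, HasRes.of_subsingleton L ?_⟩
      infer_instance

theorem HasRes.mono : ∀ {L L' : ℕ} {M : Type (max u v)} [AddCommGroup M]
    [Module (MvPolynomial σ K) M] {gr : ℕ → AddSubgroup M} {b b' : ℕ}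
    (_ : HasRes K σ L M gr b) (_ : L ≤ L') (_ : b ≤ b'), HasRes K σ L' M gr b'
  | 0, L', _, _, _, _, _, _, h, _, _ => HasRes.of_subsingleton L' h
  | L + 1, 0, _, _, _, _, _, _, h, h', _ => by omega
  | L + 1, L' + 1, _, _, _, _, _, _, h, h', hb => by
      obtain ⟨ι, _, d, m, h1, h2, h3, h4⟩ := h
      exact ⟨ι, inferInstance, d, m, fun a => (h1 a).trans hb, h2, h3, HasRes.mono h4 (by omega) (by omega)⟩

theorem HasRes.horseshoe : ∀ {L : ℕ} {B D : Type (max u v)} [AddCommGroup B]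
    [Module (MvPolynomial σ K) B] [AddCommGroup D] [Module (MvPolynomial σ K) D]
    {gB : ℕ → AddSubgroup B} {gC : ℕ → AddSubgroup D} {b : ℕ}
    (_ : IsGr K σ gB) (_ : IsGr K σ gC)
    (g : B →ₗ[MvPolynomial σ K] D) (_ : ∀ n x, x ∈ gB n → g x ∈ gC n) (_ : Function.Surjective g)
    (_ : HasRes K σ L (LinearMap.ker g) (subGr gB _) b) (_ : HasRes K σ L D gC b),
    HasRes K σ L B gB b
  | 0, B, D, _, _, _, _, gB, gC, b, hB, hC, g, hg, hs, h1, h2 => by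
      have h1 : Subsingleton (LinearMap.ker g) := h1
      have h2 : Subsingleton D := h2
      refine ⟨fun x y => ?_⟩
      have hx : x ∈ LinearMap.ker g := Subsingleton.elim _ _
      have hy : y ∈ LinearMap.ker g := Subsingleton.elim _ _
      exact congrArg Subtype.val (Subsingleton.elim (⟨x, hx⟩ : LinearMap.ker g) ⟨y, hy⟩)
  | L + 1, B, D, _, _, _, _, gB, gC, b, hB, hC, g, hg, hs, h1, h2 => by
      obtain ⟨κ, _, e, c, k1, k2, k3, k4⟩ := h2
      obtain ⟨ι, _, d, m, h1, h2, h3, h4⟩ := h1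
      choose t ht1 ht2 using fun k => hB.strict hC g hg hs (e k) (c k) (k2 k)
      have hgm : ∀ w, g (Fintype.linearCombination (MvPolynomial σ K) (fun a => (m a : B)) w) = 0 := by
        intro w
        rw [lc_map]
        simp [Fintype.linearCombination_apply]
      have hgt : ∀ w, g (Fintype.linearCombination (MvPolynomial σ K) t w) =
          Fintype.linearCombination (MvPolynomial σ K) c w := by
        intro w
        rw [lc_map]
        simp [ht2]
      have hm' : ∀ x, g x = 0 → ∃ w,
          Fintype.linearCombination (MvPolynomial σ K) (fun a => (m a : B)) w = x := by
        intro x hx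
        obtain ⟨w, hw⟩ := h3 ⟨x, hx⟩
        refine ⟨w, ?_⟩
        have := lc_map m (LinearMap.ker g).subtype w
        rw [hw] at this
        exact this.symm
      have hgr : ∀ a, Sum.elim (fun a => (m a : B)) t a ∈ gB (Sum.elim d e a) := by
        rintro (a | a)
        · exact h2 a
        · exact ht1 a
      refine ⟨ι ⊕ κ, inferInstance, Sum.elim d e, Sum.elim (fun a => (m a : B)) t, ?_, hgr, ?_, ?_⟩
      · rintro (a | a)
        · exact h1 a
        · exact k1 a
      · intro x
        obtain ⟨w, hw⟩ := k3 (g x)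
        obtain ⟨w', hw'⟩ := hm' (x - Fintype.linearCombination (MvPolynomial σ K) t w)
          (by rw [map_sub, hgt, hw, sub_self])
        refine ⟨Sum.elim w' w, ?_⟩
        rw [lc_sum]
        simp only [Sum.elim_inl, Sum.elim_inr]
        rw [hw', sub_add_cancel]
      · let g1 : LinearMap.ker (Fintype.linearCombination (MvPolynomial σ K)
            (Sum.elim (fun a => (m a : B)) t)) →ₗ[MvPolynomial σ K]
            LinearMap.ker (Fintype.linearCombination (MvPolynomial σ K) c) :=
          { toFun := fun w => ⟨fun a => w.1 (Sum.inr a), by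
              have := LinearMap.mem_ker.1 w.2
              rw [lc_sum] at this
              have := congrArg g this
              rw [map_add, hgm, zero_add, hgt, map_zero] at this
              exact this⟩
            map_add' := fun _ _ => rfl
            map_smul' := fun _ _ => rfl }
        refine HasRes.horseshoe (isGr_lc_ker hB _ _ hgr) (isGr_lc_ker hC e c k2) g1 ?_ ?_ ?_ k4
        · intro n x hx a
          exact hx (Sum.inr a)
        · rintro ⟨w, hw⟩
          obtain ⟨w', hw'⟩ := hm' (- Fintype.linearCombination (MvPolynomial σ K) t w)
            (by rw [map_neg, hgt, LinearMap.mem_ker.1 hw, neg_zero])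
          refine ⟨⟨Sum.elim w' w, ?_⟩, rfl⟩
          rw [LinearMap.mem_ker, lc_sum]
          simp only [Sum.elim_inl, Sum.elim_inr]
          rw [hw', neg_add_cancel]
        · have hval : ∀ w, ((Fintype.linearCombination (MvPolynomial σ K) m w : LinearMap.ker g) : B)
              = Fintype.linearCombination (MvPolynomial σ K) (fun a => (m a : B)) w := fun w =>
            lc_map m (LinearMap.ker g).subtype w
          have hk : ∀ w : LinearMap.ker (Fintype.linearCombination (MvPolynomial σ K) m),
              Sum.elim w.1 0 ∈ LinearMap.ker (Fintype.linearCombination (MvPolynomial σ K)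
                (Sum.elim (fun a => (m a : B)) t)) := by
            intro w
            rw [LinearMap.mem_ker, lc_sum]
            simp only [Sum.elim_inl, Sum.elim_inr, Pi.zero_apply]
            have h0 := congrArg Subtype.val (LinearMap.mem_ker.1 w.2)
            rw [hval] at h0
            have h00 := (Fintype.linearCombination (MvPolynomial σ K) t).map_zero
            rw [Pi.zero_def] at h00
            rw [h00, add_zero]
            exact h0
          have hk2 : ∀ w : LinearMap.ker (Fintype.linearCombination (MvPolynomial σ K) m),
              (⟨(Sum.elim w.1 0 : ι ⊕ κ → MvPolynomial σ K), hk w⟩ :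
                LinearMap.ker (Fintype.linearCombination (MvPolynomial σ K)
                (Sum.elim (fun a => (m a : B)) t))) ∈ LinearMap.ker g1 := by
            intro w
            rw [LinearMap.mem_ker]
            rfl
          refine h4.congr (LinearEquiv.ofBijective
            { toFun := fun w => (⟨⟨Sum.elim w.1 0, hk w⟩, hk2 w⟩ : LinearMap.ker g1)
              map_add' := ?_
              map_smul' := ?_ } ⟨?_, ?_⟩) ?_
          · intro x y
            ext1; ext1; ext1 a
            rcases a with a | a <;> simp
          · intro r x
            ext1; ext1; ext1 a
            rcases a with a | a <;> simp
          · intro x y hxy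
            have := congrArg (fun z => z.1.1) hxy
            ext1
            ext1 a
            exact congrFun this (Sum.inl a)
          · rintro ⟨⟨w, hw⟩, hw'⟩
            have hw2 : ∀ a, w (Sum.inr a) = 0 := by
              intro a
              have := congrArg Subtype.val (LinearMap.mem_ker.1 hw')
              exact congrFun this a
            refine ⟨⟨fun a => w (Sum.inl a), ?_⟩, ?_⟩
            · rw [LinearMap.mem_ker]
              ext1
              rw [hval]
              rw [LinearMap.mem_ker, lc_sum] at hw
              simp only [hw2] at hw
              have h00 := (Fintype.linearCombination (MvPolynomial σ K) t).map_zero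
              rw [Pi.zero_def] at h00
              rw [h00, add_zero] at hw
              exact hw
            · ext1; ext1; ext1 a
              rcases a with a | a
              · rfl
              · exact (hw2 a).symm
          · intro n x hx a
            rcases a with a | a
            · exact hx a
            · exact ⟨Submodule.zero_mem _, fun _ => rfl⟩

theorem HasRes.cone {L : ℕ} {B D : Type (max u v)} [AddCommGroup B]
    [Module (MvPolynomial σ K) B] [AddCommGroup D] [Module (MvPolynomial σ K) D]
    {gB : ℕ → AddSubgroup B} {gC : ℕ → AddSubgroup D} {b : ℕ}
    (hB : IsGr K σ gB) (hC : IsGr K σ gC)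
    (g : B →ₗ[MvPolynomial σ K] D) (hg : ∀ n x, x ∈ gB n → g x ∈ gC n)
    (hs : Function.Surjective g)
    (h1 : HasRes K σ L (LinearMap.ker g) (subGr gB _) (b + 1)) (h2 : HasRes K σ (L + 1) B gB b) :
    HasRes K σ (L + 1) D gC b := by
  obtain ⟨ι, _, d, m, k1, k2, k3, k4⟩ := h2
  have hl : ∀ w, Fintype.linearCombination (MvPolynomial σ K) (fun a => g (m a)) w =
          g (Fintype.linearCombination (MvPolynomial σ K) m w) := fun w =>
        (lc_map m g w).symm
  refine ⟨ι, inferInstance, d, fun a => g (m a), k1, fun a => hg _ _ (k2 a), ?_, ?_⟩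
  · intro y
    obtain ⟨x, rfl⟩ := hs y
    obtain ⟨w, rfl⟩ := k3 x
    exact ⟨w, hl w⟩
  · let g1 : LinearMap.ker (Fintype.linearCombination (MvPolynomial σ K)
            (fun a => g (m a))) →ₗ[MvPolynomial σ K] LinearMap.ker g :=
          { toFun := fun w => ⟨Fintype.linearCombination (MvPolynomial σ K) m w.1, by
              rw [LinearMap.mem_ker, ← hl]; exact w.2⟩
            map_add' := fun _ _ => by ext1; simp
            map_smul' := fun _ _ => by ext1; simp }
    refine HasRes.horseshoe (isGr_lc_ker hC d _ fun a => hg _ _ (k2 a)) (hB.ker hC g hg) g1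
      ?_ ?_ ?_ h1
    · intro n x hx
      exact lc_graded hB d m k2 n x.1 hx
    · rintro ⟨x, hx⟩
      obtain ⟨w, rfl⟩ := k3 x
      refine ⟨⟨w, ?_⟩, rfl⟩
      rw [LinearMap.mem_ker, hl]
      exact hx
    · have hk : ∀ w : LinearMap.ker (Fintype.linearCombination (MvPolynomial σ K) m),
          w.1 ∈ LinearMap.ker (Fintype.linearCombination (MvPolynomial σ K) (fun a => g (m a))) := by
        intro w
        rw [LinearMap.mem_ker, hl, LinearMap.mem_ker.1 w.2, map_zero]
      have hk2 : ∀ w, (⟨w.1, hk w⟩ : LinearMap.ker _) ∈ LinearMap.ker g1 := by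
        intro w
        rw [LinearMap.mem_ker]
        ext1
        exact w.2
      refine k4.congr (LinearEquiv.ofBijective
            { toFun := fun w => (⟨⟨w.1, hk w⟩, hk2 w⟩ : LinearMap.ker g1)
              map_add' := ?_
              map_smul' := ?_ } ⟨?_, ?_⟩) ?_
      · intro x y; rfl
      · intro x y; rfl
      · intro x y hxy
        have := congrArg (fun z => z.1.1) hxy
        ext1
        exact this
      · rintro ⟨⟨w, hw⟩, hw'⟩
        exact ⟨⟨w, congrArg Subtype.val (LinearMap.mem_ker.1 hw')⟩, rfl⟩
      · intro n x hx
        exact hx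

/-- shifted grading -/
noncomputable def shGr {M : Type*} [AddCommGroup M] (gr : ℕ → AddSubgroup M) (e n : ℕ) : AddSubgroup M :=
  if e ≤ n then gr (n - e) else ⊥

theorem HasRes.shift : ∀ {L : ℕ} {M : Type (max u v)} [AddCommGroup M]
    [Module (MvPolynomial σ K) M] {gr : ℕ → AddSubgroup M} {b : ℕ} (e : ℕ)
    (_ : HasRes K σ L M gr b), HasRes K σ L M (shGr gr e) (b + e)
  | 0, M, _, _, gr, b, e, h => h
  | L + 1, M, _, _, gr, b, e, h => by
      obtain ⟨ι, _, d, m, k1, k2, k3, k4⟩ := h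
      refine ⟨ι, inferInstance, fun a => d a + e, m, fun a => Nat.add_le_add_right (k1 a) e, fun a => ?_, k3, ?_⟩
      · simp [shGr, k2 a]
      · have := (HasRes.shift e k4).congr (gr' := subGr (Fgr K σ (fun a => d a + e)) _)
          (LinearEquiv.refl _ _) ?_
        · rwa [show b + 1 + e = b + e + 1 by omega] at this
        · intro n x hx a
          simp only [shGr] at hx
          split_ifs at hx with h
          · have := hx a
            change x.1 a ∈ homogeneousSubmodule σ K (n - (d a + e)) ∧ _
            rw [show n - (d a + e) = n - e - d a by omega]
            exact ⟨this.1, fun h' => this.2 (by dsimp only at h'; omega)⟩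
          · have : x = 0 := hx
            subst this
            exact ⟨Submodule.zero_mem _, fun _ => rfl⟩

theorem HasRes.free {ι : Type} [Fintype ι] (d : ι → ℕ) (b : ℕ) (hd : ∀ a, d a ≤ b) :
    HasRes K σ 1 (ι → MvPolynomial σ K) (Fgr K σ d) b := by
  classical
  have hl : ∀ w, Fintype.linearCombination (MvPolynomial σ K)
      (fun a => (Pi.single a 1 : ι → MvPolynomial σ K)) w = w := by
    intro w
    rw [Fintype.linearCombination_apply]
    ext1 a
    simp [Finset.sum_apply, Pi.single_apply]
  refine ⟨ι, inferInstance, d, fun a => Pi.single a 1, hd, single_mem_Fgr d, fun w => ⟨w, hl w⟩, ?_⟩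
  refine ⟨fun x y => ?_⟩
  ext1
  rw [← hl x.1, ← hl y.1]
  rw [LinearMap.mem_ker.1 x.2, LinearMap.mem_ker.1 y.2]

end

end S14

namespace S14

universe u v

section
variable {K : Type u} [Field K] {σ : Type v}

theorem HasRes.step {L : ℕ} {M : Type (max u v)} [AddCommGroup M]
    [Module (MvPolynomial σ K) M] {gr : ℕ → AddSubgroup M} {b : ℕ}
    (N : Submodule (MvPolynomial σ K) M) {ι : Type} [Fintype ι] (d : ι → ℕ) (m : ι → M)
    (hd : ∀ a, d a ≤ b) (hm : ∀ a, m a ∈ gr (d a))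
    (hr : LinearMap.range (Fintype.linearCombination (MvPolynomial σ K) m) = N)
    (h : HasRes K σ L (LinearMap.ker (Fintype.linearCombination (MvPolynomial σ K) m))
        (subGr (Fgr K σ d) _) (b + 1)) :
    HasRes K σ (L + 1) N (subGr gr N) b := by
  classical
  have hmN : ∀ a, m a ∈ N := by
    intro a
    rw [← hr]
    exact ⟨Pi.single a 1, by simp [Fintype.linearCombination_apply, Pi.single_apply]⟩
  have hval : ∀ w, ((Fintype.linearCombination (MvPolynomial σ K)
      (fun a => (⟨m a, hmN a⟩ : N)) w : N) : M)
      = Fintype.linearCombination (MvPolynomial σ K) m w := fun w =>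
    lc_map _ N.subtype w
  refine ⟨ι, inferInstance, d, fun a => ⟨m a, hmN a⟩, hd, hm, ?_, ?_⟩
  · rintro ⟨x, hx⟩
    have hx' := hx
    rw [← hr] at hx'
    obtain ⟨w, rfl⟩ := hx'
    exact ⟨w, Subtype.ext (hval w)⟩
  · refine h.congr (LinearEquiv.ofEq _ _ ?_) ?_
    · ext w
      rw [LinearMap.mem_ker, LinearMap.mem_ker, Subtype.ext_iff, hval]
      rfl
    · intro n x hx
      exact hx

theorem HasRes.of_seq {L r : ℕ} (k : ℕ → ℕ) (d : (i : ℕ) → Fin (k i) → ℕ)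
    (m : (i : ℕ) → Fin (k (i + 1)) → (Fin (k i) → MvPolynomial σ K))
    (hk : ∀ i, L ≤ i → k i = 0)
    (hm : ∀ i b, m i b ∈ Fgr K σ (d i) (d (i + 1) b))
    (hr : ∀ i, LinearMap.range (Fintype.linearCombination (MvPolynomial σ K) (m (i + 1))) =
      LinearMap.ker (Fintype.linearCombination (MvPolynomial σ K) (m i)))
    (hd : ∀ i a, d i a ≤ i + r) : ∀ t i, L ≤ i + 1 + t →
      HasRes K σ t (LinearMap.ker (Fintype.linearCombination (MvPolynomial σ K) (m i)))
        (subGr (Fgr K σ (d (i + 1))) _) (i + 2 + r)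
  | 0, i, h => by
      have := hk (i + 1) h
      have : IsEmpty (Fin (k (i + 1))) := by rw [this]; infer_instance
      change Subsingleton _
      infer_instance
  | t + 1, i, h => by
      refine HasRes.step _ (d (i + 2)) (m (i + 1)) (hd (i + 2)) (hm (i + 1)) (hr i) ?_
      have := HasRes.of_seq k d m hk hm hr hd t (i + 1) (by omega)
      rwa [show i + 1 + 2 + r = i + 2 + r + 1 by omega] at this

theorem lc_equiv {M : Type*} [AddCommGroup M] [Module (MvPolynomial σ K) M] {k : ℕ}
    (f : (Fin k →₀ MvPolynomial σ K) →ₗ[MvPolynomial σ K] M) (w : Fin k → MvPolynomial σ K) :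
    Fintype.linearCombination (MvPolynomial σ K) (fun a => f (Finsupp.single a 1)) w =
      f (Finsupp.equivFunOnFinite.symm w) := by
  rw [Fintype.linearCombination_apply]
  conv_rhs => rw [← Finsupp.univ_sum_single (Finsupp.equivFunOnFinite.symm w)]
  rw [map_sum]
  refine Finset.sum_congr rfl fun a _ => ?_
  rw [← map_smul, Finsupp.smul_single, smul_eq_mul, mul_one]
  rfl

theorem HasRes.of_regBound (I : Ideal (MvPolynomial σ K)) (r : ℕ) (h : regBound K I r) :
    ∃ L, HasRes K σ L (MvPolynomial σ K ⧸ I) (qgr I) r := by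
  obtain ⟨L, k, d, φ, ε, h1, h2, h3, h4, h5, h6, h7⟩ := h
  let m : (i : ℕ) → Fin (k (i + 1)) → (Fin (k i) → MvPolynomial σ K) :=
    fun i b => ⇑(φ i (Finsupp.single b 1))
  have hm : ∀ i w, Fintype.linearCombination (MvPolynomial σ K) (m i) w =
      ⇑(φ i (Finsupp.equivFunOnFinite.symm w)) := by
    intro i w
    rw [← lc_equiv]
    exact (lc_map (M' := Fin (k i) → MvPolynomial σ K) _
      (Finsupp.linearEquivFunOnFinite (MvPolynomial σ K) (MvPolynomial σ K) (Fin (k i))).toLinearMap w).symm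
  have hk : ∀ i w, w ∈ LinearMap.ker (Fintype.linearCombination (MvPolynomial σ K) (m i)) ↔
      Finsupp.equivFunOnFinite.symm w ∈ LinearMap.ker (φ i) := by
    intro i w
    rw [LinearMap.mem_ker, LinearMap.mem_ker, hm]
    exact ⟨fun h => DFunLike.coe_injective h, fun h => by rw [h]; rfl⟩
  have hr : ∀ i w, w ∈ LinearMap.range (Fintype.linearCombination (MvPolynomial σ K) (m i)) ↔
      Finsupp.equivFunOnFinite.symm w ∈ LinearMap.range (φ i) := by
    intro i w
    constructor
    · rintro ⟨v, rfl⟩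
      refine ⟨Finsupp.equivFunOnFinite.symm v, ?_⟩
      rw [hm]
      exact (Equiv.symm_apply_apply _ _).symm
    · rintro ⟨v, hv⟩
      refine ⟨⇑v, ?_⟩
      rw [hm]
      have : Finsupp.equivFunOnFinite.symm (⇑v) = v := Equiv.symm_apply_apply _ _
      rw [this, hv]
      rfl
  have key := HasRes.of_seq (r := r) k d m h1 (fun i b a => h2 i b a)
    (fun i => by ext w; rw [hr, hk, h6]) h7 L 0 (by omega)
  refine ⟨L + 1 + 1, Fin (k 0), inferInstance, d 0, fun a => ε (Finsupp.single a 1),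
    fun a => by simpa using h7 0 a, h3, ?_, ?_⟩
  · intro y
    obtain ⟨v, rfl⟩ := h4 y
    refine ⟨⇑v, ?_⟩
    rw [lc_equiv]
    exact congrArg ε (Equiv.symm_apply_apply _ _)
  · refine HasRes.step _ (d 1) (m 0) (fun a => by have := h7 1 a; omega) (fun b a => h2 0 b a) ?_ ?_
    · ext w
      rw [hr, h5, LinearMap.mem_ker, LinearMap.mem_ker, lc_equiv]
    · rwa [show r + 1 + 1 = 0 + 2 + r by omega]

theorem HasRes.fin {L : ℕ} {M : Type (max u v)} [AddCommGroup M]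
    [Module (MvPolynomial σ K) M] {gr : ℕ → AddSubgroup M} {b : ℕ}
    (h : HasRes K σ (L + 1) M gr b) : ∃ (c : ℕ) (d : Fin c → ℕ) (m : Fin c → M),
      (∀ a, d a ≤ b) ∧ (∀ a, m a ∈ gr (d a)) ∧
      Function.Surjective (Fintype.linearCombination (MvPolynomial σ K) m) ∧
      HasRes K σ L (LinearMap.ker (Fintype.linearCombination (MvPolynomial σ K) m))
        (subGr (Fgr K σ d) _) (b + 1) := by
  obtain ⟨ι, _, d, m, h1, h2, h3, h4⟩ := h
  let e := (Fintype.equivFin ι).symm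
  have hl : ∀ w : ι → MvPolynomial σ K,
      Fintype.linearCombination (MvPolynomial σ K) (fun a => m (e a)) (fun a => w (e a)) =
      Fintype.linearCombination (MvPolynomial σ K) m w := by
    intro w
    simp only [Fintype.linearCombination_apply]
    exact e.sum_comp (fun a => w a • m a)
  refine ⟨Fintype.card ι, fun a => d (e a), fun a => m (e a), fun a => h1 _, fun a => h2 _, ?_, ?_⟩
  · intro y
    obtain ⟨w, rfl⟩ := h3 y
    exact ⟨_, hl w⟩
  · refine h4.congr (LinearEquiv.ofBijective
            { toFun := fun w => (⟨fun a => w.1 (e a), ?_⟩ : LinearMap.ker (Fintype.linearCombination (MvPolynomial σ K) (fun a => m (e a))))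
              map_add' := ?_
              map_smul' := ?_ } ⟨?_, ?_⟩) ?_
    · rw [LinearMap.mem_ker, hl]; exact w.2
    · intro x y; rfl
    · intro x y; rfl
    · intro x y hxy
      ext1; ext1 a
      have := congrFun (congrArg Subtype.val hxy) (e.symm a)
      simpa using this
    · rintro ⟨w, hw⟩
      refine ⟨⟨fun a => w (e.symm a), ?_⟩, ?_⟩
      · rw [LinearMap.mem_ker, ← hl]
        simpa using hw
      · ext1; ext1 a
        simp
    · intro n x hx a
      exact hx (e a)

theorem HasRes.to_seq : ∀ {L : ℕ} {M : Type (max u v)} [AddCommGroup M]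
    [Module (MvPolynomial σ K) M] {gr : ℕ → AddSubgroup M} {b : ℕ}
    (_ : HasRes K σ L M gr b),
    ∃ (k : ℕ → ℕ) (d : (i : ℕ) → Fin (k i) → ℕ)
    (m : (i : ℕ) → Fin (k (i + 1)) → (Fin (k i) → MvPolynomial σ K))
    (g : Fin (k 0) → M), (∀ i, L ≤ i → k i = 0) ∧
    (∀ i b, m i b ∈ Fgr K σ (d i) (d (i + 1) b)) ∧ (∀ a, g a ∈ gr (d 0 a)) ∧
    Function.Surjective (Fintype.linearCombination (MvPolynomial σ K) g) ∧
    (LinearMap.range (Fintype.linearCombination (MvPolynomial σ K) (m 0)) =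
      LinearMap.ker (Fintype.linearCombination (MvPolynomial σ K) g)) ∧
    (∀ i, LinearMap.range (Fintype.linearCombination (MvPolynomial σ K) (m (i + 1))) =
      LinearMap.ker (Fintype.linearCombination (MvPolynomial σ K) (m i))) ∧
    (∀ i a, d i a ≤ i + b)
  | 0, M, _, _, gr, b, h => by
      have : Subsingleton M := h
      refine ⟨fun _ => 0, fun _ a => a.elim0, fun _ a => a.elim0, fun a => a.elim0, fun _ _ => rfl,
        fun _ a => a.elim0, fun a => a.elim0, fun y => ⟨0, Subsingleton.elim _ _⟩, ?_, ?_,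
        fun _ a => a.elim0⟩
      · exact Subsingleton.elim _ _
      · intro i
        exact Subsingleton.elim _ _
  | L + 1, M, _, _, gr, b, h => by
      obtain ⟨c, d0, g0, h1, h2, h3, h4⟩ := h.fin
      obtain ⟨k, d, m, g, k1, k2, k3, k4, k5, k6, k7⟩ := HasRes.to_seq h4
      have hval : ∀ w, ((Fintype.linearCombination (MvPolynomial σ K) g w :
          LinearMap.ker (Fintype.linearCombination (MvPolynomial σ K) g0)) : Fin c → MvPolynomial σ K)
        = Fintype.linearCombination (MvPolynomial σ K) (fun a => (g a).1) w := fun w =>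
        lc_map _ (Submodule.subtype _) w
      let k' : ℕ → ℕ := fun i => Nat.casesOn i c k
      let d' : (i : ℕ) → Fin (k' i) → ℕ := fun i =>
        Nat.casesOn (motive := fun i => Fin (k' i) → ℕ) i d0 d
      let m' : (i : ℕ) → Fin (k' (i + 1)) → (Fin (k' i) → MvPolynomial σ K) := fun i =>
        Nat.casesOn (motive := fun i => Fin (k' (i + 1)) → (Fin (k' i) → MvPolynomial σ K)) i
          (fun a => (g a).1) m
      refine ⟨k', d', m', g0, ?_, ?_, h2, h3, ?_, ?_, ?_⟩
      · rintro (_ | i) hi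
        · omega
        · exact k1 i (by omega)
      · rintro (_ | i) a
        · exact k3 a
        · exact k2 i a
      · ext w
        constructor
        · rintro ⟨v, rfl⟩
          have := (Fintype.linearCombination (MvPolynomial σ K) g v).2
          rw [hval] at this
          exact this
        · intro hw
          obtain ⟨v, hv⟩ := k4 ⟨w, hw⟩
          refine ⟨v, ?_⟩
          have := congrArg Subtype.val hv
          rw [hval] at this
          exact this
      · rintro (_ | i)
        · refine Eq.trans k5 ?_
          ext w
          rw [LinearMap.mem_ker, Subtype.ext_iff, hval]
          rfl
        · exact k6 i
      · rintro (_ | i) a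
        · have := h1 a
          change d0 a ≤ _
          omega
        · have := k7 i a
          change d i a ≤ _
          omega

theorem HasRes.to_regBound (I : Ideal (MvPolynomial σ K)) (r L : ℕ)
    (h : HasRes K σ L (MvPolynomial σ K ⧸ I) (qgr I) r) : regBound K I r := by
  obtain ⟨k, d, m, g, k1, k2, k3, k4, k5, k6, k7⟩ := h.to_seq
  let E : (i : ℕ) → (Fin (k i) →₀ MvPolynomial σ K) ≃ₗ[MvPolynomial σ K] (Fin (k i) → MvPolynomial σ K) :=
    fun i => Finsupp.linearEquivFunOnFinite _ _ _
  let φ : (i : ℕ) → ((Fin (k (i + 1)) →₀ MvPolynomial σ K) →ₗ[MvPolynomial σ K]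
      (Fin (k i) →₀ MvPolynomial σ K)) := fun i =>
    (E i).symm.toLinearMap ∘ₗ Fintype.linearCombination (MvPolynomial σ K) (m i) ∘ₗ
      (E (i + 1)).toLinearMap
  let ε : (Fin (k 0) →₀ MvPolynomial σ K) →ₗ[MvPolynomial σ K] (MvPolynomial σ K ⧸ I) :=
    Fintype.linearCombination (MvPolynomial σ K) g ∘ₗ (E 0).toLinearMap
  have hφ : ∀ i w, E i (φ i w) = Fintype.linearCombination (MvPolynomial σ K) (m i) (E (i + 1) w) :=
    fun i w => (E i).apply_symm_apply _
  have hE1 : ∀ i b, E i (Finsupp.single b 1) = Pi.single b 1 := by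
    intro i b
    ext1 a
    simp [E, Finsupp.single_apply, Pi.single_apply, eq_comm]
  have hφ1 : ∀ i b a, (φ i (Finsupp.single b 1)) a = m i b a := by
    intro i b a
    have : (φ i (Finsupp.single b 1)) a = E i (φ i (Finsupp.single b 1)) a := rfl
    rw [this, hφ, hE1, Fintype.linearCombination_apply_single, one_smul]
  have hk : ∀ i w, w ∈ LinearMap.ker (φ i) ↔
      E (i + 1) w ∈ LinearMap.ker (Fintype.linearCombination (MvPolynomial σ K) (m i)) := by
    intro i w
    rw [LinearMap.mem_ker, LinearMap.mem_ker, ← hφ, LinearEquiv.map_eq_zero_iff]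
  have hr : ∀ i w, w ∈ LinearMap.range (φ i) ↔
      E i w ∈ LinearMap.range (Fintype.linearCombination (MvPolynomial σ K) (m i)) := by
    intro i w
    constructor
    · rintro ⟨v, rfl⟩
      exact ⟨_, (hφ i v).symm⟩
    · rintro ⟨v, hv⟩
      refine ⟨(E (i + 1)).symm v, (E i).injective ?_⟩
      rw [hφ, LinearEquiv.apply_symm_apply, hv]
  refine ⟨L, k, d, φ, ε, k1, ?_, ?_, ?_, ?_, ?_, k7⟩
  · intro i b a
    rw [hφ1]
    exact k2 i b a
  · intro a
    have : ε (Finsupp.single a 1) = g a := by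
      change Fintype.linearCombination (MvPolynomial σ K) g (E 0 (Finsupp.single a 1)) = _
      rw [hE1, Fintype.linearCombination_apply_single, one_smul]
    rw [this]
    exact k3 a
  · exact k4.comp (E 0).surjective
  · ext w
    rw [hr, k5]
    rfl
  · intro i
    ext w
    rw [hr, k6, hk]

end

end S14

namespace S14

universe u v

section
variable {K : Type u} [Field K] {σ : Type v}

theorem factor_graded {I J : Ideal (MvPolynomial σ K)} (h : I ≤ J) (n : ℕ)
    (x : MvPolynomial σ K ⧸ I) (hx : x ∈ qgr I n) : Submodule.factor h x ∈ qgr J n := by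
  obtain ⟨p, hp, rfl⟩ := (mem_qgr _ _ _).1 hx
  exact (mem_qgr _ _ _).2 ⟨p, hp, rfl⟩

theorem HasRes.kerFactor {I J Q : Ideal (MvPolynomial σ K)} (h : I ≤ J) (m : MvPolynomial σ K)
    (e : ℕ) (hm : m ∈ homogeneousSubmodule σ K e)
    (hJ : ∀ p, p ∈ J → ∃ q, p - m * q ∈ I) (hmJ : m ∈ J)
    (hQ : ∀ p, m * p ∈ I ↔ p ∈ Q) {L b : ℕ}
    (hres : HasRes K σ L (MvPolynomial σ K ⧸ Q) (qgr Q) b) :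
    HasRes K σ L (LinearMap.ker (Submodule.factor h)) (subGr (qgr I) _) (b + e) := by
  let f0 : MvPolynomial σ K →ₗ[MvPolynomial σ K] MvPolynomial σ K ⧸ I :=
    (Submodule.mkQ I) ∘ₗ (LinearMap.mulLeft (MvPolynomial σ K) m)
  have hf0 : Q ≤ LinearMap.ker f0 := by
    intro p hp
    rw [LinearMap.mem_ker]
    exact (Submodule.Quotient.mk_eq_zero _).2 ((hQ p).2 hp)
  let f1 : (MvPolynomial σ K ⧸ Q) →ₗ[MvPolynomial σ K] MvPolynomial σ K ⧸ I :=
    Submodule.liftQ Q f0 hf0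
  have hf1 : ∀ p, f1 (Submodule.mkQ Q p) = Submodule.mkQ I (m * p) := fun p => rfl
  have hf2 : ∀ x, f1 x ∈ LinearMap.ker (Submodule.factor h) := by
    intro x
    obtain ⟨p, rfl⟩ := Submodule.mkQ_surjective Q x
    rw [hf1, LinearMap.mem_ker, Submodule.factor_mk]
    exact (Submodule.Quotient.mk_eq_zero _).2 (J.mul_mem_right _ hmJ)
  refine (hres.shift e).congr (LinearEquiv.ofBijective (f1.codRestrict _ hf2) ⟨?_, ?_⟩) ?_
  · rw [← LinearMap.ker_eq_bot, LinearMap.ker_codRestrict, LinearMap.ker_eq_bot']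
    intro x hx
    obtain ⟨p, rfl⟩ := Submodule.mkQ_surjective Q x
    rw [hf1] at hx
    exact (Submodule.Quotient.mk_eq_zero _).2 ((hQ p).1 ((Submodule.Quotient.mk_eq_zero _).1 hx))
  · rintro ⟨y, hy⟩
    obtain ⟨p, rfl⟩ := Submodule.mkQ_surjective I y
    rw [LinearMap.mem_ker, Submodule.factor_mk] at hy
    obtain ⟨q, hq⟩ := hJ p ((Submodule.Quotient.mk_eq_zero _).1 hy)
    refine ⟨Submodule.mkQ Q q, ?_⟩
    ext1
    change Submodule.mkQ I (m * q) = Submodule.mkQ I p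
    exact ((Submodule.Quotient.eq _).2 hq).symm
  · intro n x hx
    rw [mem_subGr]
    change f1 x ∈ _
    unfold shGr at hx
    split_ifs at hx with hn
    · obtain ⟨p, hp, rfl⟩ := (mem_qgr _ _ _).1 hx
      refine (mem_qgr _ _ _).2 ⟨m * p, ?_, rfl⟩
      have := IsHomogeneous.mul hm hp
      rwa [Nat.add_sub_cancel' hn] at this
    · have : x = 0 := hx
      subst this
      rw [map_zero]
      exact AddSubgroup.zero_mem _

theorem HasRes.bot (I : Ideal (MvPolynomial σ K)) (hI : I = ⊥) :
    HasRes K σ 1 (MvPolynomial σ K ⧸ I) (qgr I) 0 := by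
  have hl : ∀ w, Fintype.linearCombination (MvPolynomial σ K)
      (fun _ : Unit => Submodule.mkQ I 1) w = Submodule.mkQ I (w ()) := by
    intro w
    rw [Fintype.linearCombination_apply]
    simp only [Finset.univ_unique, Finset.sum_singleton]
    rw [← map_smul, smul_eq_mul, mul_one]
  refine ⟨Unit, inferInstance, fun _ => 0, fun _ => Submodule.mkQ I 1, fun _ => le_rfl, ?_, ?_, ?_⟩
  · intro _
    exact (mem_qgr _ _ _).2 ⟨1, isHomogeneous_one σ K, rfl⟩
  · intro y
    obtain ⟨p, rfl⟩ := Submodule.mkQ_surjective I y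
    exact ⟨fun _ => p, hl _⟩
  · refine ⟨fun x y => ?_⟩
    have key : ∀ x : LinearMap.ker (Fintype.linearCombination (MvPolynomial σ K)
      (fun _ : Unit => Submodule.mkQ I 1)), x.1 () = 0 := by
      intro x
      have := LinearMap.mem_ker.1 x.2
      rw [hl, Submodule.mkQ_apply, Submodule.Quotient.mk_eq_zero] at this
      have h2 : ∀ p ∈ I, p = 0 := by rw [hI]; exact fun p hp => hp
      exact h2 _ this
    ext1; ext1 a
    rw [key x, key y]

theorem HI_X (s : Set σ) : HI (Ideal.span (MvPolynomial.X '' s : Set (MvPolynomial σ K))) := by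
  apply HI_span
  rintro p ⟨i, _, rfl⟩
  exact ⟨1, isHomogeneous_X K i⟩

theorem HasRes.koszul (T : Finset σ) : ∃ L,
    HasRes K σ L (MvPolynomial σ K ⧸ Ideal.span (MvPolynomial.X '' (T : Set σ) : Set (MvPolynomial σ K)))
      (qgr _) 0 := by
  classical
  induction T using Finset.induction_on with
  | empty => exact ⟨1, HasRes.bot _ (by simp)⟩
  | insert i T hi ih =>
    obtain ⟨L, hL⟩ := ih
    have hle : Ideal.span (MvPolynomial.X '' (T : Set σ) : Set (MvPolynomial σ K)) ≤
        Ideal.span (MvPolynomial.X '' ((insert i T : Finset σ) : Set σ)) :=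
      Ideal.span_mono (Set.image_mono (by simp))
    refine ⟨L + 1, HasRes.cone (isGr_qgr _ (HI_X _)) (isGr_qgr _ (HI_X _)) (Submodule.factor hle)
      (factor_graded hle) (Submodule.factor_surjective hle)
      (HasRes.kerFactor hle (MvPolynomial.X i) 1 (isHomogeneous_X K i) ?_ ?_ ?_ hL)
      (hL.mono (Nat.le_succ L) le_rfl)⟩
    · intro p hp
      rw [Finset.coe_insert, Set.image_insert_eq, Ideal.mem_span_insert] at hp
      obtain ⟨a, z, hz, rfl⟩ := hp
      refine ⟨a, ?_⟩
      rwa [mul_comm a, add_sub_cancel_left]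
    · exact Ideal.subset_span ⟨i, by simp, rfl⟩
    · intro p
      rw [mem_ideal_span_X_image, mem_ideal_span_X_image]
      constructor
      · intro h m hm
        obtain ⟨j, hj, hj'⟩ := h (Finsupp.single i 1 + m) (by
          rw [mem_support_iff, coeff_X_mul]; exact mem_support_iff.1 hm)
        refine ⟨j, hj, ?_⟩
        have : j ≠ i := by rintro rfl; exact hi hj
        simpa [Finsupp.single_apply, this.symm] using hj'
      · intro h m hm
        rw [mem_support_iff, coeff_X_mul'] at hm
        split_ifs at hm with hh
        · obtain ⟨j, hj, hj'⟩ := h _ (mem_support_iff.2 hm)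
          refine ⟨j, hj, ?_⟩
          intro h0
          apply hj'
          simp [h0]
        · exact absurd rfl hm

end

section
variable (K : Type u) [Field K] (V : Type v)

/-- set the new variable to zero -/
noncomputable def rho : MvPolynomial (Option V) K →ₐ[K] MvPolynomial V K :=
  aeval (fun o => Option.elim o 0 MvPolynomial.X)

/-- the inclusion -/
noncomputable def iot : MvPolynomial V K →ₐ[K] MvPolynomial (Option V) K := rename some

variable {K V}

theorem rho_hom {n : ℕ} {p : MvPolynomial (Option V) K}
    (hp : p ∈ homogeneousSubmodule (Option V) K n) : rho K V p ∈ homogeneousSubmodule V K n := by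
  have := IsHomogeneous.aeval (n := 1) hp (fun o => Option.elim o (0 : MvPolynomial V K) MvPolynomial.X) (by
    rintro (_ | i)
    · exact isHomogeneous_zero _ _ _
    · exact isHomogeneous_X _ _)
  rwa [one_mul] at this

theorem iot_hom {n : ℕ} {p : MvPolynomial V K}
    (hp : p ∈ homogeneousSubmodule V K n) : iot K V p ∈ homogeneousSubmodule (Option V) K n :=
  IsHomogeneous.rename_isHomogeneous hp

theorem rho_some (i : V) : rho K V (MvPolynomial.X (some i)) = MvPolynomial.X i := by
  simp [rho]
theorem rho_none : rho K V (MvPolynomial.X none) = 0 := by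
  simp [rho]
theorem iot_X (i : V) : iot K V (MvPolynomial.X i) = MvPolynomial.X (some i) := by
  simp [iot]
theorem rho_iot (p : MvPolynomial V K) : rho K V (iot K V p) = p := by
  have : (rho K V).comp (iot K V) = AlgHom.id _ _ := by
    ext i; simp [rho_some, iot_X]
  exact DFunLike.congr_fun this p

theorem sub_iot_rho (p : MvPolynomial (Option V) K) :
    ∃ q, p - iot K V (rho K V p) = MvPolynomial.X none * q := by
  induction p using MvPolynomial.induction_on with
  | C a => exact ⟨0, by simp [rho, iot]⟩
  | add p q hp hq =>
    obtain ⟨a, ha⟩ := hp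
    obtain ⟨b, hb⟩ := hq
    refine ⟨a + b, ?_⟩
    rw [mul_add, ← ha, ← hb, map_add, map_add]
    ring
  | mul_X p o hp =>
    obtain ⟨a, ha⟩ := hp
    rcases o with _ | i
    · refine ⟨p, ?_⟩
      rw [map_mul, rho_none, mul_zero, map_zero, sub_zero, mul_comm]
    · refine ⟨a * MvPolynomial.X (some i), ?_⟩
      rw [map_mul, rho_some, map_mul, iot_X, ← mul_assoc, ← ha]
      ring

set_option synthInstance.maxHeartbeats 400000 in
theorem HasRes.restrict : ∀ {L : ℕ} {M M' : Type (max u v)} [AddCommGroup M]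
    [Module (MvPolynomial V K) M] [AddCommGroup M'] [Module (MvPolynomial (Option V) K) M']
    {gr : ℕ → AddSubgroup M} {gr' : ℕ → AddSubgroup M'} {b : ℕ} (_ : IsGr K V gr)
    (_ : IsGr K (Option V) gr') (f : M' ≃+ M)
    (_ : ∀ r x, f (r • x) = rho K V r • f x)
    (_ : ∀ n x, f x ∈ gr n ↔ x ∈ gr' n) (_ : HasRes K V L M gr b),
    ∃ L', HasRes K (Option V) L' M' gr' b
  | 0, M, M', _, _, _, _, gr, gr', b, _, _, f, _, _, h => by
      have : Subsingleton M := h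
      exact ⟨0, f.injective.subsingleton⟩
  | L + 1, M, M', _, _, _, _, gr, gr', b, hgr, hgr', f, hf, hfg, h => by
      obtain ⟨ι, _, d, m, h1, h2, h3, h4⟩ := h
      let m' : ι → M' := fun a => f.symm (m a)
      have hfm : ∀ w, f (Fintype.linearCombination (MvPolynomial (Option V) K) m' w) =
          Fintype.linearCombination (MvPolynomial V K) m (fun a => rho K V (w a)) := by
        intro w
        simp [Fintype.linearCombination_apply, map_sum, hf, m']
      have hm' : ∀ a, m' a ∈ gr' (d a) := fun a => by
        rw [← hfg]; simpa [m'] using h2 a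
      letI instN : Module (MvPolynomial (Option V) K)
          (LinearMap.ker (Fintype.linearCombination (MvPolynomial V K) m)) :=
        Module.compHom _ (rho K V).toRingHom
      have hsm : ∀ (r : MvPolynomial (Option V) K)
          (x : LinearMap.ker (Fintype.linearCombination (MvPolynomial V K) m)),
          r • x = rho K V r • x := fun r x => rfl
      have hN := isGr_lc_ker hgr d m h2
      have hN' : IsGr K (Option V) (subGr (Fgr K V d) (LinearMap.ker
          (Fintype.linearCombination (MvPolynomial V K) m))) :=
        ⟨fun i n r x hr hx => by rw [hsm]; exact hN.smul i n _ x (rho_hom hr) hx, hN.comp⟩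
      obtain ⟨L', hL'⟩ := HasRes.restrict hN hN' (AddEquiv.refl _) (fun r x => rfl)
        (fun n x => Iff.rfl) h4
      let g : LinearMap.ker (Fintype.linearCombination (MvPolynomial (Option V) K) m')
          →ₗ[MvPolynomial (Option V) K]
          LinearMap.ker (Fintype.linearCombination (MvPolynomial V K) m) :=
        { toFun := fun w => ⟨fun a => rho K V (w.1 a), by
            rw [LinearMap.mem_ker, ← hfm, LinearMap.mem_ker.1 w.2, map_zero]⟩
          map_add' := fun x y => by ext1; ext1 a; simp
          map_smul' := fun r x => by
            rw [hsm]
            ext1; ext1 a; simp }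
      have hker : HasRes K (Option V) 1 (LinearMap.ker g)
          (subGr (subGr (Fgr K (Option V) d) _) _) (b + 1) := by
        have hr0 : ∀ (w : ι → MvPolynomial (Option V) K) a,
            rho K V (((MvPolynomial.X none : MvPolynomial (Option V) K) • w) a) = 0 := by
          intro w a
          rw [Pi.smul_apply, smul_eq_mul, map_mul, rho_none, zero_mul]
        have hk : ∀ w : ι → MvPolynomial (Option V) K, (MvPolynomial.X none : MvPolynomial (Option V) K) • w ∈
            LinearMap.ker (Fintype.linearCombination (MvPolynomial (Option V) K) m') := by
          intro w
          rw [LinearMap.mem_ker]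
          apply f.injective
          rw [hfm, map_zero]
          simp only [hr0]
          exact map_zero _
        have hk2 : ∀ w : ι → MvPolynomial (Option V) K,
            (⟨(MvPolynomial.X none : MvPolynomial (Option V) K) • w, hk w⟩ :
              LinearMap.ker (Fintype.linearCombination (MvPolynomial (Option V) K) m')) ∈
            LinearMap.ker g := by
          intro w
          rw [LinearMap.mem_ker]
          ext1; ext1 a
          exact hr0 w a
        refine (HasRes.free (K := K) (σ := Option V) (fun a => d a + 1) (b + 1)
          (fun a => Nat.succ_le_succ (h1 a))).congr (LinearEquiv.ofBijective
            { toFun := fun w => (⟨⟨(MvPolynomial.X none : MvPolynomial (Option V) K) • w, hk w⟩, hk2 w⟩ : LinearMap.ker g)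
              map_add' := ?_
              map_smul' := ?_ } ⟨?_, ?_⟩) ?_
        · intro x y
          ext1; ext1
          exact smul_add _ _ _
        · intro r x
          ext1; ext1
          exact smul_comm _ _ _
        · intro x y hxy
          have := congrArg (fun z => z.1.1) hxy
          ext1 a
          have := congrFun this a
          exact mul_left_cancel₀ (MvPolynomial.X_ne_zero none) this
        · rintro ⟨⟨w, hw⟩, hw'⟩
          have h0 : ∀ a, rho K V (w a) = 0 := by
            intro a
            exact congrFun (congrArg Subtype.val (LinearMap.mem_ker.1 hw')) a
          choose v hv using fun a => sub_iot_rho (w a)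
          refine ⟨v, ?_⟩
          ext1; ext1; ext1 a
          have := hv a
          rw [h0, map_zero, sub_zero] at this
          exact this.symm
        · intro n x hx a
          change MvPolynomial.X none * x a ∈ _ ∧ (_ → MvPolynomial.X none * x a = 0)
          have hxa := hx a
          simp only at hxa
          by_cases hn : n < d a + 1
          · rw [hxa.2 hn, mul_zero]
            exact ⟨Submodule.zero_mem _, fun _ => rfl⟩
          · refine ⟨?_, fun h => by omega⟩
            have := IsHomogeneous.mul (isHomogeneous_X K (none : Option V)) hxa.1
            rwa [show 1 + (n - (d a + 1)) = n - d a by omega] at this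
      refine ⟨max 1 L' + 1, ι, inferInstance, d, m', h1, hm', ?_, ?_⟩
      · intro y
        obtain ⟨w, hw⟩ := h3 (f y)
        refine ⟨fun a => iot K V (w a), f.injective ?_⟩
        rw [hfm]
        simpa only [rho_iot] using hw
      · refine HasRes.horseshoe (isGr_lc_ker hgr' d m' hm') hN' g ?_ ?_
          (hker.mono (le_max_left _ _) le_rfl) (hL'.mono (le_max_right _ _) le_rfl)
        · intro n x hx a
          exact ⟨rho_hom (hx a).1, fun h => by
            have := (hx a).2 h
            change rho K V (x.1 a) = 0
            rw [show x.1 a = 0 from this, map_zero]⟩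
        · rintro ⟨w, hw⟩
          refine ⟨⟨fun a => iot K V (w a), ?_⟩, ?_⟩
          · rw [LinearMap.mem_ker]
            apply f.injective
            rw [hfm, map_zero]
            simp only [rho_iot]
            exact hw
          · ext1; ext1 a
            exact rho_iot _

end

end S14

namespace S14

universe u v

section
variable {K : Type u} [Field K] {V : Type v}

theorem HI_edge (G : SimpleGraph V) : HI (edgeIdeal K G) := by
  apply HI_span
  rintro p ⟨i, j, _, rfl⟩
  exact ⟨1 + 1, IsHomogeneous.mul (isHomogeneous_X K i) (isHomogeneous_X K j)⟩

theorem edge_low (G : SimpleGraph V) (p : MvPolynomial V K) (hp : p ∈ edgeIdeal K G) (n : ℕ)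
    (hn : n ≤ 1) (hh : p ∈ homogeneousSubmodule V K n) : p = 0 := by
  have hle : edgeIdeal K G ≤ idealOfVars V K ^ 2 := by
    apply Ideal.span_le.2
    rintro q ⟨i, j, _, rfl⟩
    rw [pow_two]
    exact Ideal.mul_mem_mul (Ideal.subset_span ⟨i, rfl⟩) (Ideal.subset_span ⟨j, rfl⟩)
  have h2 := (mem_pow_idealOfVars_iff' 2 p).1 (hle hp)
  ext s
  rw [coeff_zero]
  by_contra hs
  have h3 : Finsupp.degree s = n := by
    have := (mem_homogeneousSubmodule n p).1 hh hs
    rwa [Finsupp.degree_eq_weight_one]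
  exact hs (h2 s (by omega))

theorem no_res_zero (G : SimpleGraph V) (i j : V) (hij : G.Adj i j) (L : ℕ)
    (h : HasRes K V L (MvPolynomial V K ⧸ edgeIdeal K G) (qgr _) 0) : False := by
  classical
  have hone : (1 : MvPolynomial V K) ∉ edgeIdeal K G := fun h1 =>
    one_ne_zero (edge_low G 1 h1 0 (by omega) (isHomogeneous_one V K))
  have h' := h.mono (show L ≤ L + 1 + 1 by omega) le_rfl
  obtain ⟨ι, _, d, m, h1, h2, h3, κ, _, e, g, k1, k2, k3, k4⟩ := h'
  choose c hc hcm using fun a => (mem_qgr _ _ _).1 (h2 a)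
  have hlam : ∀ w, Ideal.Quotient.mk (edgeIdeal K G)
      (Fintype.linearCombination (MvPolynomial V K) c w) =
      Fintype.linearCombination (MvPolynomial V K) m w := by
    intro w
    have := lc_map c (Submodule.mkQ (edgeIdeal K G)) w
    rw [show m = fun a => Submodule.mkQ (edgeIdeal K G) (c a) from funext fun a => (hcm a).symm]
    exact this
  have hz : ∀ b, Fintype.linearCombination (MvPolynomial V K) c (g b).1 = 0 := by
    intro b
    refine edge_low G _ ?_ (e b) (k1 b) ?_
    · rw [← Ideal.Quotient.eq_zero_iff_mem, hlam]
      exact (g b).2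
    · exact lc_graded isGr_hgr d c hc (e b) (g b).1 (k2 b)
  have hz2 : ∀ w ∈ LinearMap.ker (Fintype.linearCombination (MvPolynomial V K) m),
      Fintype.linearCombination (MvPolynomial V K) c w = 0 := by
    intro w hw
    obtain ⟨v, hv⟩ := k3 ⟨w, hw⟩
    have := lc_map g ((Fintype.linearCombination (MvPolynomial V K) c) ∘ₗ Submodule.subtype _) v
    rw [hv] at this
    change Fintype.linearCombination (MvPolynomial V K) c w = _ at this
    rw [this, Fintype.linearCombination_apply]
    refine Finset.sum_eq_zero fun b _ => ?_
    change v b • Fintype.linearCombination (MvPolynomial V K) c (g b).1 = 0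
    rw [hz, smul_zero]
  have hc0 : ∀ a, c a = 0 := by
    intro a
    have := hz2 (Pi.single a (MvPolynomial.X i * MvPolynomial.X j)) (by
      rw [LinearMap.mem_ker, ← hlam, Fintype.linearCombination_apply_single,
        Ideal.Quotient.eq_zero_iff_mem]
      exact Ideal.mul_mem_right _ _ (Ideal.subset_span ⟨i, j, hij, rfl⟩))
    rw [Fintype.linearCombination_apply_single, smul_eq_mul] at this
    rcases mul_eq_zero.1 this with h | h
    · rcases mul_eq_zero.1 h with h | h
      · exact absurd h (MvPolynomial.X_ne_zero i)
      · exact absurd h (MvPolynomial.X_ne_zero j)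
    · exact h
  obtain ⟨w, hw⟩ := h3 (Ideal.Quotient.mk _ 1)
  rw [← hlam, show c = 0 from funext hc0] at hw
  have h0 : Fintype.linearCombination (MvPolynomial V K) (0 : ι → MvPolynomial V K) w = 0 := by
    simp [Fintype.linearCombination_apply]
  rw [h0, map_zero] at hw
  exact hone (Ideal.Quotient.eq_zero_iff_mem.1 hw.symm)

theorem rho_comp (n : ℕ) (p : MvPolynomial (Option V) K) :
    homogeneousComponent n (rho K V p) = rho K V (homogeneousComponent n p) := by
  refine commute (gr := hgr K (Option V)) (gr' := hgr K V)
    (fun n => (homogeneousComponent n).toAddMonoidHom)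
    (fun n => (homogeneousComponent n).toAddMonoidHom) ?_ ?_ ?_ ?_ ?_ ?_
    (rho K V).toRingHom.toAddMonoidHom ?_ n p
  · intro n m; exact homogeneousComponent_mem _ _
  · intro n m hm; exact homogeneousComponent_eq_self hm
  · intro n k m hnk hm
    change homogeneousComponent k m = 0
    rw [homogeneousComponent_of_mem hm, if_neg hnk.symm]
  · intro m
    exact ⟨m.totalDegree + 1, (sum_homogeneousComponent m).symm⟩
  · intro n m hm; exact homogeneousComponent_eq_self hm
  · intro n k m hnk hm
    change homogeneousComponent k m = 0
    rw [homogeneousComponent_of_mem hm, if_neg hnk.symm]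
  · intro n m hm
    exact rho_hom hm

variable (G : SimpleGraph V) (S : Set V)

theorem susp_ss (x y : V) : (sSusp G S).Adj (some x) (some y) ↔ G.Adj x y := by
  simp only [sSusp, SimpleGraph.fromRel_adj]
  constructor
  · rintro ⟨_, (⟨a, b, h1, h2, h⟩ | ⟨h, _⟩) | (⟨a, b, h1, h2, h⟩ | ⟨h, _⟩)⟩
    · cases h1; cases h2; exact h
    · cases h
    · cases h1; cases h2; exact h.symm
    · cases h
  · intro h
    exact ⟨fun h' => h.ne (Option.some.inj h'), Or.inl (Or.inl ⟨x, y, rfl, rfl, h⟩)⟩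

theorem susp_ns (y : V) : (sSusp G S).Adj none (some y) ↔ y ∉ S := by
  simp only [sSusp, SimpleGraph.fromRel_adj]
  constructor
  · rintro ⟨_, (⟨a, b, h1, h2, h⟩ | ⟨_, z, hz, h⟩) | (⟨a, b, h1, h2, h⟩ | ⟨h, _⟩)⟩
    · cases h1
    · cases hz; exact h
    · cases h2
    · cases h
  · intro h
    exact ⟨by simp, Or.inl (Or.inr ⟨by trivial, y, rfl, h⟩)⟩

theorem iot_mem (p : MvPolynomial V K) (hp : p ∈ edgeIdeal K G) :
    iot K V p ∈ edgeIdeal K (sSusp G S) := by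
  have : edgeIdeal K G ≤ (edgeIdeal K (sSusp G S)).comap (iot K V) := by
    apply Ideal.span_le.2
    rintro q ⟨i, j, h, rfl⟩
    refine Ideal.mem_comap.2 ?_
    rw [map_mul, iot_X, iot_X]
    exact Ideal.subset_span ⟨_, _, (susp_ss G S i j).2 h, rfl⟩
  exact this hp

theorem rho_mem (p : MvPolynomial (Option V) K) (hp : p ∈ edgeIdeal K (sSusp G S)) :
    rho K V p ∈ edgeIdeal K G := by
  have : edgeIdeal K (sSusp G S) ≤ (edgeIdeal K G).comap (rho K V) := by
    apply Ideal.span_le.2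
    rintro q ⟨i, j, h, rfl⟩
    refine Ideal.mem_comap.2 ?_
    rw [map_mul]
    rcases i with _ | i
    · rw [rho_none, zero_mul]; exact Ideal.zero_mem _
    rcases j with _ | j
    · rw [rho_none, mul_zero]; exact Ideal.zero_mem _
    rw [rho_some, rho_some]
    exact Ideal.subset_span ⟨_, _, (susp_ss G S i j).1 h, rfl⟩
  exact this hp

theorem colon (hS : ∀ x ∈ S, ∀ y ∈ S, ¬ G.Adj x y) (T : Set (Option V)) (hT : T = some '' Sᶜ)
    (p : MvPolynomial (Option V) K) :
    MvPolynomial.X none * p ∈ edgeIdeal K (sSusp G S) ↔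
      p ∈ Ideal.span (MvPolynomial.X '' T : Set (MvPolynomial (Option V) K)) := by
  classical
  constructor
  · intro h
    have hle : edgeIdeal K (sSusp G S) ≤
        Ideal.span (MvPolynomial.X '' T : Set (MvPolynomial (Option V) K)) := by
      have hX : ∀ x, x ∉ S → (MvPolynomial.X (some x) : MvPolynomial (Option V) K) ∈
          Ideal.span (MvPolynomial.X '' T : Set (MvPolynomial (Option V) K)) := by
        intro x hx
        exact Ideal.subset_span ⟨some x, by rw [hT]; exact ⟨x, hx, rfl⟩, rfl⟩
      apply Ideal.span_le.2
      rintro q ⟨i, j, h, rfl⟩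
      rcases i with _ | i
      · rcases j with _ | j
        · exact absurd h ((sSusp G S).loopless.irrefl _)
        · exact Ideal.mul_mem_left _ _ (hX _ ((susp_ns G S j).1 h))
      rcases j with _ | j
      · exact Ideal.mul_mem_right _ _ (hX _ ((susp_ns G S i).1 h.symm))
      by_cases hi : i ∈ S
      · refine Ideal.mul_mem_left _ _ (hX _ fun hj => hS i hi j hj ((susp_ss G S i j).1 h))
      · exact Ideal.mul_mem_right _ _ (hX _ hi)
    have h := hle h
    rw [mem_ideal_span_X_image] at h ⊢
    intro m hm
    obtain ⟨j, hj, hj'⟩ := h (Finsupp.single none 1 + m) (by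
      rw [mem_support_iff, coeff_X_mul]; exact mem_support_iff.1 hm)
    refine ⟨j, hj, ?_⟩
    have : j ≠ none := by
      rintro rfl
      rw [hT] at hj
      obtain ⟨x, _, hx⟩ := hj
      cases hx
    simpa [Finsupp.single_apply, this.symm] using hj'
  · intro h
    have hle : Ideal.span (MvPolynomial.X '' T : Set (MvPolynomial (Option V) K)) ≤
        Submodule.comap (LinearMap.mulLeft (MvPolynomial (Option V) K) (MvPolynomial.X none))
          (edgeIdeal K (sSusp G S)) := by
      apply Ideal.span_le.2
      rintro q ⟨i, hi, rfl⟩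
      rw [hT] at hi
      obtain ⟨x, hx, rfl⟩ := hi
      exact Ideal.subset_span ⟨none, some x, (susp_ns G S x).2 hx, rfl⟩
    exact hle h

theorem partA [Fintype V] (hS : ∀ x ∈ S, ∀ y ∈ S, ¬ G.Adj x y) (L r : ℕ) (hr : 1 ≤ r)
    (h : HasRes K V L (MvPolynomial V K ⧸ edgeIdeal K G) (qgr _) r) :
    ∃ L', HasRes K (Option V) L' (MvPolynomial (Option V) K ⧸ edgeIdeal K (sSusp G S)) (qgr _) r := by
  classical
  let J1 : Ideal (MvPolynomial (Option V) K) := (edgeIdeal K G).comap (rho K V).toRingHom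
  have hJ1 : ∀ p, p ∈ J1 ↔ rho K V p ∈ edgeIdeal K G := fun p => Iff.rfl
  have hHI : HI J1 := by
    intro p hp n
    rw [hJ1] at hp ⊢
    rw [← rho_comp]
    exact HI_edge G _ hp n
  have hle : edgeIdeal K (sSusp G S) ≤ J1 := fun p hp => rho_mem G S p hp
  let T : Finset (Option V) := (Finset.univ.filter (fun x => x ∉ S)).image some
  have hT : (T : Set (Option V)) = some '' Sᶜ := by
    ext x; simp [T]
  obtain ⟨L1, hL1⟩ := HasRes.koszul (K := K) T
  have hker := HasRes.kerFactor hle (MvPolynomial.X none) 1 (isHomogeneous_X K none)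
    (fun p hp => by
      obtain ⟨q, hq⟩ := sub_iot_rho p
      refine ⟨q, ?_⟩
      rw [← hq, sub_sub_cancel]
      exact iot_mem G S _ hp)
    (by rw [hJ1, rho_none]; exact Ideal.zero_mem _)
    (colon G S hS _ hT) hL1
  let f0 : (MvPolynomial (Option V) K ⧸ J1) →+* (MvPolynomial V K ⧸ edgeIdeal K G) :=
    Ideal.quotientMap _ (rho K V).toRingHom le_rfl
  have hf0 : ∀ p, f0 (Ideal.Quotient.mk J1 p) = Ideal.Quotient.mk _ (rho K V p) := fun p => rfl
  have hinj : Function.Injective f0 := Ideal.quotientMap_injective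
  have hsurj : Function.Surjective f0 := by
    intro y
    obtain ⟨p, rfl⟩ := Ideal.Quotient.mk_surjective y
    exact ⟨Ideal.Quotient.mk _ (iot K V p), by rw [hf0, rho_iot]⟩
  obtain ⟨L2, hL2⟩ := HasRes.restrict (gr' := qgr J1) (isGr_qgr _ (HI_edge G)) (isGr_qgr J1 hHI)
    (AddEquiv.ofBijective f0.toAddMonoidHom ⟨hinj, hsurj⟩)
    (by
      intro r x
      obtain ⟨p, rfl⟩ := Ideal.Quotient.mk_surjective x
      change f0 (Ideal.Quotient.mk J1 (r * p)) = Ideal.Quotient.mk _ (rho K V r * rho K V p)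
      rw [hf0, map_mul])
    (by
      intro n x
      change f0 x ∈ _ ↔ _
      constructor
      · intro hx
        obtain ⟨p, hp, hpx⟩ := (mem_qgr _ _ _).1 hx
        refine (mem_qgr _ _ _).2 ⟨iot K V p, iot_hom hp, hinj ?_⟩
        rw [hf0, rho_iot, hpx]
      · intro hx
        obtain ⟨p, hp, rfl⟩ := (mem_qgr _ _ _).1 hx
        exact (mem_qgr _ _ _).2 ⟨_, rho_hom hp, rfl⟩) h
  exact ⟨max L1 L2, HasRes.horseshoe (isGr_qgr _ (HI_edge _)) (isGr_qgr J1 hHI)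
    (Submodule.factor hle) (factor_graded hle) (Submodule.factor_surjective hle)
    (hker.mono (le_max_left _ _) (by omega)) (hL2.mono (le_max_right _ _) le_rfl)⟩

end

end S14

namespace S14

universe u v

section
variable {K : Type u} [Field K] {σ : Type v}

theorem lc_self {ι : Type} [Fintype ι] [DecidableEq ι] {M : Type*} [AddCommGroup M]
    [Module (MvPolynomial σ K) M] (q : (ι → MvPolynomial σ K) →ₗ[MvPolynomial σ K] M)
    (w : ι → MvPolynomial σ K) :
    Fintype.linearCombination (MvPolynomial σ K) (fun a => q (Pi.single a 1)) w = q w := by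
  rw [Fintype.linearCombination_apply]
  conv_rhs => rw [pi_eq_sum_univ' w]
  rw [map_sum]
  refine Finset.sum_congr rfl fun a _ => ?_
  rw [← map_smul]

theorem dropGen {M : Type*} [AddCommGroup M] [Module (MvPolynomial σ K) M] {n : ℕ}
    (m : Fin (n + 1) → M)
    (hs : Function.Surjective (Fintype.linearCombination (MvPolynomial σ K) m))
    (v : Fin (n + 1) → MvPolynomial σ K)
    (hv : Fintype.linearCombination (MvPolynomial σ K) m v = 0) (a : Fin (n + 1)) (c : K)
    (hc : c ≠ 0) (hva : v a = MvPolynomial.C c) :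
    Function.Surjective (Fintype.linearCombination (MvPolynomial σ K) (fun x => m (a.succAbove x))) := by
  rw [Fintype.linearCombination_apply, Fin.sum_univ_succAbove _ a, hva] at hv
  have hma : m a = ∑ x, (- (MvPolynomial.C c⁻¹ * v (a.succAbove x))) • m (a.succAbove x) := by
    have h1 : (MvPolynomial.C c⁻¹ : MvPolynomial σ K) • (MvPolynomial.C c : MvPolynomial σ K) • m a = m a := by
      rw [smul_smul, ← MvPolynomial.C_mul, inv_mul_cancel₀ hc, MvPolynomial.C_1, one_smul]
    rw [← h1, eq_neg_of_add_eq_zero_left hv, smul_neg, Finset.smul_sum, ← Finset.sum_neg_distrib]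
    refine Finset.sum_congr rfl fun x _ => ?_
    rw [smul_smul, neg_smul]
  intro y
  obtain ⟨w, rfl⟩ := hs y
  refine ⟨fun x => w (a.succAbove x) + w a * (- (MvPolynomial.C c⁻¹ * v (a.succAbove x))), ?_⟩
  simp only [Fintype.linearCombination_apply]
  rw [Fin.sum_univ_succAbove _ a]
  conv_rhs => rw [hma]
  rw [Finset.smul_sum, ← Finset.sum_add_distrib]
  refine Finset.sum_congr rfl fun x _ => ?_
  rw [add_smul, mul_smul, add_comm]

theorem HasRes.proj {M : Type (max u v)} [AddCommGroup M] [Module (MvPolynomial σ K) M]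
    {gr : ℕ → AddSubgroup M} {b : ℕ} (hM : IsGr K σ gr) {κ : Type} [Fintype κ] (e : κ → ℕ)
    (he : ∀ c, e c ≤ b) (s : M →ₗ[MvPolynomial σ K] (κ → MvPolynomial σ K))
    (q : (κ → MvPolynomial σ K) →ₗ[MvPolynomial σ K] M)
    (hs : ∀ n x, x ∈ gr n → s x ∈ Fgr K σ e n) (hq : ∀ n x, x ∈ Fgr K σ e n → q x ∈ gr n)
    (hqs : ∀ x, q (s x) = x) : HasRes K σ 1 M gr b := by
  classical
  let P : ℕ → Prop := fun n => ∃ (d : Fin n → ℕ) (m : Fin n → M), (∀ a, d a ≤ b) ∧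
    (∀ a, m a ∈ gr (d a)) ∧ Function.Surjective (Fintype.linearCombination (MvPolynomial σ K) m)
  have hP : ∃ n, P n := by
    let E := (Fintype.equivFin κ).symm
    refine ⟨Fintype.card κ, fun a => e (E a), fun a => q (Pi.single (E a) 1), fun a => he _,
      fun a => hq _ _ (single_mem_Fgr e _), ?_⟩
    intro y
    refine ⟨fun a => s y (E a), ?_⟩
    refine Eq.trans ?_ ((lc_self q (s y)).trans (hqs y))
    simp only [Fintype.linearCombination_apply]
    exact E.sum_comp (fun a => s y a • q (Pi.single a 1))
  obtain ⟨d, m, h1, h2, h3⟩ := Nat.find_spec hP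
  have hmin : ∀ n, n < Nat.find hP → ¬ P n := fun n hn => Nat.find_min hP hn
  generalize Nat.find hP = N at d m h1 h2 h3 hmin
  choose t ht1 ht2 using fun c => (isGr_Fgr d).strict hM _ (lc_graded hM d m h2) h3 (e c)
    (q (Pi.single c 1)) (hq _ _ (single_mem_Fgr e c))
  let sg : M →ₗ[MvPolynomial σ K] (Fin N → MvPolynomial σ K) :=
    Fintype.linearCombination (MvPolynomial σ K) t ∘ₗ s
  have hsg : ∀ x, Fintype.linearCombination (MvPolynomial σ K) m (sg x) = x := by
    intro x
    change Fintype.linearCombination (MvPolynomial σ K) m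
      (Fintype.linearCombination (MvPolynomial σ K) t (s x)) = x
    rw [lc_map]
    simp only [ht2]
    rw [lc_self, hqs]
  have hsgr : ∀ n x, x ∈ gr n → sg x ∈ Fgr K σ d n := fun n x hx =>
    lc_graded (isGr_Fgr d) e t ht1 n (s x) (hs n x hx)
  let ep : (Fin N → MvPolynomial σ K) →ₗ[MvPolynomial σ K] (Fin N → MvPolynomial σ K) :=
    LinearMap.id - sg ∘ₗ Fintype.linearCombination (MvPolynomial σ K) m
  have hep : ∀ v, ep v = v - sg (Fintype.linearCombination (MvPolynomial σ K) m v) := fun v => rfl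
  have hpe : ∀ v, Fintype.linearCombination (MvPolynomial σ K) m (ep v) = 0 := by
    intro v
    rw [hep, map_sub, hsg, sub_self]
  have hunit : ∀ n v, v ∈ Fgr K σ d n → Fintype.linearCombination (MvPolynomial σ K) m v = 0 →
      ∀ a, n ≤ d a → v a = 0 := by
    intro n v hv hv0 a hna
    rcases hna.lt_or_eq with h | h
    · exact (hv a).2 h
    · by_contra hne
      have h0 := (hv a).1
      rw [h, Nat.sub_self] at h0
      have hC : v a = MvPolynomial.C (coeff 0 (v a)) :=
        (totalDegree_eq_zero_iff_eq_C).1 ((totalDegree_zero_iff_isHomogeneous σ).2 h0)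
      rcases N with _ | N
      · exact a.elim0
      · refine hmin N (Nat.lt_succ_self N) ⟨fun x => d (a.succAbove x), fun x => m (a.succAbove x),
          fun x => h1 _, fun x => h2 _, dropGen m h3 v hv0 a _ ?_ hC⟩
        intro hc
        rw [hc, MvPolynomial.C_0] at hC
        exact hne hC
  have hzero : ∀ n v, v ∈ Fgr K σ d n → Fintype.linearCombination (MvPolynomial σ K) m v = 0 →
      v = 0 := by
    intro n
    induction n using Nat.strong_induction_on with
    | _ n ih =>
      intro v hv hv0
      have h5 : v = ep v := by rw [hep, hv0, map_zero, sub_zero]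
      rw [h5, ← lc_self ep v, Fintype.linearCombination_apply]
      refine Finset.sum_eq_zero fun a _ => ?_
      by_cases hna : n ≤ d a
      · rw [hunit n v hv hv0 a hna, zero_smul]
      · rw [ih (d a) (by omega) (ep (Pi.single a 1)) ?_ (hpe _), smul_zero]
        rw [hep]
        exact AddSubgroup.sub_mem _ (single_mem_Fgr d a)
          (hsgr _ _ (lc_graded hM d m h2 _ _ (single_mem_Fgr d a)))
  refine ⟨Fin N, inferInstance, d, m, h1, h2, h3, ?_⟩
  obtain ⟨c, hc1, hc2, hc3, hc4⟩ := (isGr_lc_ker hM d m h2).comp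
  have h0 : ∀ x : LinearMap.ker (Fintype.linearCombination (MvPolynomial σ K) m), x = 0 := by
    intro x
    obtain ⟨n, hn⟩ := hc4 x
    rw [hn]
    refine Finset.sum_eq_zero fun k _ => ?_
    ext1
    exact hzero k _ (hc1 k x) (LinearMap.mem_ker.1 (c k x).2)
  exact ⟨fun x y => (h0 x).trans (h0 y).symm⟩

end
end S14

namespace S14

universe u v

section
variable {K : Type u} [Field K] {V : Type v}

theorem HasRes.retract : ∀ {L : ℕ} {M N : Type (max u v)} [AddCommGroup M]
    [Module (MvPolynomial V K) M] [AddCommGroup N] [Module (MvPolynomial (Option V) K) N]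
    {gr : ℕ → AddSubgroup M} {grN : ℕ → AddSubgroup N} {b : ℕ} (_ : IsGr K V gr)
    (_ : IsGr K (Option V) grN) (i : M →+ N) (p : N →+ M)
    (_ : ∀ r x, i (r • x) = iot K V r • i x)
    (_ : ∀ r x, p (r • x) = rho K V r • p x)
    (_ : ∀ n x, x ∈ gr n → i x ∈ grN n) (_ : ∀ n x, x ∈ grN n → p x ∈ gr n)
    {κ : Type} [Fintype κ] (e : κ → ℕ) (_ : ∀ c, e c ≤ b)
    (s : M →ₗ[MvPolynomial V K] (κ → MvPolynomial V K))
    (q : (κ → MvPolynomial V K) →ₗ[MvPolynomial V K] M)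
    (_ : ∀ n x, x ∈ gr n → s x ∈ Fgr K V e n) (_ : ∀ n x, x ∈ Fgr K V e n → q x ∈ gr n)
    (_ : ∀ x, p (i x) + q (s x) = x)
    (_ : HasRes K (Option V) L N grN b), ∃ L', HasRes K V L' M gr b
  | 0, M, N, _, _, _, _, gr, grN, b, hM, hN, i, p, hi, hp, hig, hpg, κ, _, e, he, s, q, hs, hq,
      hid, h => by
      have : Subsingleton N := h
      refine ⟨1, HasRes.proj hM e he s q hs hq fun x => ?_⟩
      have := hid x
      rwa [Subsingleton.elim (i x) 0, map_zero, zero_add] at this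
  | L + 1, M, N, _, _, _, _, gr, grN, b, hM, hN, i, p, hi, hp, hig, hpg, κ, _, e, he, s, q, hs, hq,
      hid, h => by
      classical
      obtain ⟨ι, _, d, g, h1, h2, h3, h4⟩ := h
      let G1 : ι ⊕ κ → M := Sum.elim (fun a => p (g a)) (fun c => q (Pi.single c 1))
      let D1 : ι ⊕ κ → ℕ := Sum.elim d e
      have hD1 : ∀ x, D1 x ≤ b := by
        rintro (a | c)
        · exact h1 a
        · exact he c
      have hG1 : ∀ x, G1 x ∈ gr (D1 x) := by
        rintro (a | c)
        · exact hpg _ _ (h2 a)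
        · exact hq _ _ (single_mem_Fgr e c)
      have hpi : ∀ w, p (Fintype.linearCombination (MvPolynomial (Option V) K) g w) =
          Fintype.linearCombination (MvPolynomial V K) (fun a => p (g a)) (fun a => rho K V (w a)) := by
        intro w
        simp [Fintype.linearCombination_apply, map_sum, hp]
      have hpi1 : ∀ (w : ι → MvPolynomial (Option V) K) (y : κ → MvPolynomial V K),
          Fintype.linearCombination (MvPolynomial V K) G1 (Sum.elim (fun a => rho K V (w a)) y) =
          p (Fintype.linearCombination (MvPolynomial (Option V) K) g w) + q y := by
        intro w y
        rw [lc_sum, hpi]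
        simp only [Sum.elim_inl, Sum.elim_inr]
        rw [lc_self]
      choose uu hu1 hu2 using fun x => (isGr_Fgr d).strict hN _ (lc_graded hN d g h2) h3 (D1 x)
        (i (G1 x)) (hig _ _ (hG1 x))
      let ut : (ι ⊕ κ → MvPolynomial V K) → (ι → MvPolynomial (Option V) K) := fun v =>
        Fintype.linearCombination (MvPolynomial (Option V) K) uu (fun x => iot K V (v x))
      have hut_add : ∀ v w, ut (v + w) = ut v + ut w := by
        intro v w
        simp only [ut, Pi.add_apply, map_add]
        exact map_add (Fintype.linearCombination (MvPolynomial (Option V) K) uu)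
          (fun x => iot K V (v x)) (fun x => iot K V (w x))
      have hut_smul : ∀ r v, ut (r • v) = iot K V r • ut v := by
        intro r v
        simp only [ut, Pi.smul_apply, smul_eq_mul, map_mul]
        exact map_smul (Fintype.linearCombination (MvPolynomial (Option V) K) uu) (iot K V r)
          (fun x => iot K V (v x))
      have hut_pi : ∀ v, Fintype.linearCombination (MvPolynomial (Option V) K) g (ut v) =
          i (Fintype.linearCombination (MvPolynomial V K) G1 v) := by
        intro v
        simp only [ut]
        rw [lc_map]
        simp only [hu2]
        simp [Fintype.linearCombination_apply, map_sum, hi]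
      have hut_gr : ∀ n v, v ∈ Fgr K V D1 n → ut v ∈ Fgr K (Option V) d n := by
        intro n v hv
        refine lc_graded (isGr_Fgr d) D1 uu hu1 n _ fun x => ⟨iot_hom (hv x).1, fun h => ?_⟩
        change iot K V (v x) = 0
        rw [(hv x).2 h, map_zero]
      let A : (ι ⊕ κ → MvPolynomial V K) →ₗ[MvPolynomial V K] (ι → MvPolynomial V K) :=
        { toFun := fun v a => rho K V (ut v a)
          map_add' := fun v w => by ext1 a; simp [hut_add]
          map_smul' := fun r v => by ext1 a; simp [hut_smul, rho_iot] }
      have hA : ∀ v, A v = fun a => rho K V (ut v a) := fun v => rfl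
      have hAgr : ∀ n v, v ∈ Fgr K V D1 n → A v ∈ Fgr K V d n := by
        intro n v hv a
        have := hut_gr n v hv a
        refine ⟨rho_hom this.1, fun h => ?_⟩
        rw [hA]
        change rho K V (ut v a) = 0
        rw [this.2 h, map_zero]
      have hsurj : Function.Surjective (Fintype.linearCombination (MvPolynomial V K) G1) := by
        intro x
        obtain ⟨w, hw⟩ := h3 (i x)
        exact ⟨Sum.elim (fun a => rho K V (w a)) (s x), by rw [hpi1, hw, hid]⟩
      let i1 : LinearMap.ker (Fintype.linearCombination (MvPolynomial V K) G1) →+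
          LinearMap.ker (Fintype.linearCombination (MvPolynomial (Option V) K) g) :=
        { toFun := fun v => ⟨ut v.1, by
            rw [LinearMap.mem_ker, hut_pi, LinearMap.mem_ker.1 v.2, map_zero]⟩
          map_zero' := by
            ext1
            have := hut_smul 0 0
            rw [zero_smul, map_zero, zero_smul] at this
            exact this
          map_add' := fun v w => by ext1; exact hut_add _ _ }
      let p1 : LinearMap.ker (Fintype.linearCombination (MvPolynomial (Option V) K) g) →+
          LinearMap.ker (Fintype.linearCombination (MvPolynomial V K) G1) :=
        { toFun := fun w => ⟨Sum.elim (fun a => rho K V (w.1 a)) 0, by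
            rw [LinearMap.mem_ker, hpi1, LinearMap.mem_ker.1 w.2, map_zero, map_zero, add_zero]⟩
          map_zero' := by
            ext1; ext1 x; rcases x with a | c <;> simp
          map_add' := fun v w => by
            ext1; ext1 x; rcases x with a | c <;> simp }
      let q1 : (ι ⊕ κ → MvPolynomial V K) →ₗ[MvPolynomial V K]
          LinearMap.ker (Fintype.linearCombination (MvPolynomial V K) G1) :=
        { toFun := fun v => ⟨v - Sum.elim (A v)
              (s (Fintype.linearCombination (MvPolynomial V K) G1 v)), by
            rw [LinearMap.mem_ker, map_sub, hA, hpi1, hut_pi, hid, sub_self]⟩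
          map_add' := fun v w => by
            ext1; ext1 x; rcases x with a | c <;> simp <;> ring
          map_smul' := fun r v => by
            ext1; ext1 x; rcases x with a | c <;> simp <;> ring }
      obtain ⟨L', hL'⟩ := HasRes.retract (isGr_lc_ker hM D1 G1 hG1) (isGr_lc_ker hN d g h2) i1 p1
        (fun r x => by ext1; exact hut_smul _ _)
        (fun r x => by ext1; ext1 y; rcases y with a | c
                       · exact map_mul (rho K V) r (x.1 a)
                       · exact (mul_zero (rho K V r)).symm)
        (fun n x hx => hut_gr n x.1 hx)
        (fun n x hx y => by
          rcases y with a | c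
          · refine ⟨rho_hom (hx a).1, fun h => ?_⟩
            change rho K V (x.1 a) = 0
            rw [show x.1 a = 0 from (hx a).2 h, map_zero]
          · exact ⟨Submodule.zero_mem _, fun _ => rfl⟩)
        D1 (fun x => (hD1 x).trans (Nat.le_succ b)) (Submodule.subtype _) q1
        (fun n x hx => hx)
        (fun n x hx => by
          rw [mem_subGr]
          refine AddSubgroup.sub_mem _ hx ?_
          intro y
          rcases y with a | c
          · exact hAgr n x hx a
          · exact hs n _ (lc_graded hM D1 G1 hG1 n x hx) c)
        (fun x => by
          ext1
          change (Sum.elim (A x.1) 0 : ι ⊕ κ → MvPolynomial V K) + (x.1 - Sum.elim (A x.1)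
              (s (Fintype.linearCombination (MvPolynomial V K) G1 x.1))) = x.1
          rw [LinearMap.mem_ker.1 x.2, map_zero, add_sub_cancel])
        h4
      exact ⟨L' + 1, ι ⊕ κ, inferInstance, D1, G1, hD1, hG1, hsurj, hL'⟩

theorem partB (G : SimpleGraph V) (S : Set V) (L r : ℕ)
    (h : HasRes K (Option V) L (MvPolynomial (Option V) K ⧸ edgeIdeal K (sSusp G S)) (qgr _) r) :
    ∃ L', HasRes K V L' (MvPolynomial V K ⧸ edgeIdeal K G) (qgr _) r := by
  let i0 : (MvPolynomial V K ⧸ edgeIdeal K G) →+*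
      (MvPolynomial (Option V) K ⧸ edgeIdeal K (sSusp G S)) :=
    Ideal.quotientMap _ (iot K V).toRingHom (fun p hp => iot_mem G S p hp)
  let p0 : (MvPolynomial (Option V) K ⧸ edgeIdeal K (sSusp G S)) →+*
      (MvPolynomial V K ⧸ edgeIdeal K G) :=
    Ideal.quotientMap _ (rho K V).toRingHom (fun p hp => rho_mem G S p hp)
  have hi0 : ∀ p, i0 (Ideal.Quotient.mk _ p) = Ideal.Quotient.mk _ (iot K V p) := fun p => rfl
  have hp0 : ∀ p, p0 (Ideal.Quotient.mk _ p) = Ideal.Quotient.mk _ (rho K V p) := fun p => rfl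
  refine HasRes.retract (isGr_qgr _ (HI_edge G)) (isGr_qgr _ (HI_edge _)) i0.toAddMonoidHom
    p0.toAddMonoidHom ?_ ?_ ?_ ?_ (κ := Empty) (fun c => c.elim) (fun c => c.elim) 0 0 ?_ ?_ ?_ h
  · intro r x
    obtain ⟨p, rfl⟩ := Ideal.Quotient.mk_surjective x
    change i0 (Ideal.Quotient.mk _ (r * p)) = Ideal.Quotient.mk _ (iot K V r * iot K V p)
    rw [hi0, map_mul]
  · intro r x
    obtain ⟨p, rfl⟩ := Ideal.Quotient.mk_surjective x
    change p0 (Ideal.Quotient.mk _ (r * p)) = Ideal.Quotient.mk _ (rho K V r * rho K V p)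
    rw [hp0, map_mul]
  · intro n x hx
    obtain ⟨p, hp, rfl⟩ := (mem_qgr _ _ _).1 hx
    exact (mem_qgr _ _ _).2 ⟨_, iot_hom hp, rfl⟩
  · intro n x hx
    obtain ⟨p, hp, rfl⟩ := (mem_qgr _ _ _).1 hx
    exact (mem_qgr _ _ _).2 ⟨_, rho_hom hp, rfl⟩
  · intro n x hx a
    exact a.elim
  · intro n x hx
    exact AddSubgroup.zero_mem _
  · intro x
    obtain ⟨p, rfl⟩ := Ideal.Quotient.mk_surjective x
    change p0 (i0 (Ideal.Quotient.mk _ p)) + 0 = _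
    rw [hi0, hp0, rho_iot, add_zero]

theorem main [Fintype V] (G : SimpleGraph V)
    (hiso : ∀ v : V, ∃ w, G.Adj v w) (S : Set V)
    (hS : ∀ x ∈ S, ∀ y ∈ S, ¬ G.Adj x y) :
    reg K (edgeIdeal K (sSusp G S)) = reg K (edgeIdeal K G) := by
  rcases isEmpty_or_nonempty V with hV | ⟨⟨v⟩⟩
  · have h0 : ∀ {W : Type v} (H : SimpleGraph W), (∀ i j, ¬ H.Adj i j) → reg K (edgeIdeal K H) = 0 := by
      intro W H hH
      have : edgeIdeal K H = ⊥ := by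
        rw [edgeIdeal, Ideal.span_eq_bot]
        rintro p ⟨i, j, h, rfl⟩
        exact absurd h (hH i j)
      exact Nat.sInf_eq_zero.2 (Or.inl (HasRes.to_regBound _ 0 1 (HasRes.bot _ this)))
    rw [h0, h0]
    · intro i; exact hV.elim i
    · intro i j h
      rcases i with _ | i
      · rcases j with _ | j
        · exact (sSusp G S).loopless.irrefl _ h
        · exact hV.elim j
      · exact hV.elim i
  · obtain ⟨w, hw⟩ := hiso v
    unfold reg
    congr 1
    ext r
    constructor
    · intro h
      obtain ⟨L, hL⟩ := HasRes.of_regBound _ r h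
      obtain ⟨L', hL'⟩ := partB G S L r hL
      exact HasRes.to_regBound _ r L' hL'
    · intro h
      obtain ⟨L, hL⟩ := HasRes.of_regBound _ r h
      have hr : 1 ≤ r := by
        by_contra hr
        obtain rfl : r = 0 := by omega
        exact no_res_zero G v w hw L hL
      obtain ⟨L', hL'⟩ := partA G S hS L r hr hL
      exact HasRes.to_regBound _ r L' hL'

end
end S14
/-- the `S`-suspension preserves the regularity of `R/I(G)` when `G`
has no isolated vertex and `S` is independent. -/
theorem stmt_14 (K : Type*) [Field K] {V : Type*} [Fintype V] (G : SimpleGraph V)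
    (hiso : ∀ v : V, ∃ w, G.Adj v w) (S : Set V)
    (hS : ∀ x ∈ S, ∀ y ∈ S, ¬ G.Adj x y) :
    reg K (edgeIdeal K (sSusp G S)) = reg K (edgeIdeal K G) := by
  exact S14.main G hiso S hS
end
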